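/- arXiv:1012.5688 — 13 statements merged into one kernel-verified Lean document; each statement's English description precedes it below -/
import Mathlib

section
/- Let E be a topological space equipped with its Borel σ-algebra and let P be a Markov kernel on E. Let Φ : [0,∞) → ℝ be continuously differentiable, increasing, with Φ'(1) > 0 and Φ(r) → ∞ as r → ∞, and let Ψ : E×E → [0,∞) be such that for every x ∈ E, Ψ(x,y) + Ψ(y,x) → 0 as y → x. Suppose that for all x, y ∈ E and every bounded measurable f : E → [0,∞) one has Φ(Pf(x)) ≤ (P(Φ∘f))(y)·exp(Ψ(x,y)). Then P is strong Feller, i.e. for every bounded measurable f : E → ℝ the map x ↦ Pf(x) is continuous on E. -/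
open MeasureTheory ProbabilityTheory Filter

/-- A function continuous on `[0, ∞)` composed with a bounded nonnegative measurable function is
measurable. -/
lemma ContinuousOn.measurable_comp_of_nonneg {E : Type*} [MeasurableSpace E] {Φ : ℝ → ℝ}
    (hΦ : ContinuousOn Φ (Set.Ici 0)) {h : E → ℝ} (hh : Measurable h) (h0 : ∀ z, 0 ≤ h z) :
    Measurable fun z => Φ (h z) := by
  have hcont : Continuous fun t : ℝ => Φ (max t 0) :=
    hΦ.comp_continuous (by fun_prop) fun t => le_max_right t 0
  simpa [Function.comp_def, max_eq_left (h0 _)] using hcont.measurable.comp hh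

/-- A bounded measurable function is integrable with respect to a probability measure, and its
mean obeys the same bound. -/
lemma integrable_and_abs_integral_le_of_abs_le {E : Type*} [MeasurableSpace E] (μ : Measure E)
    [IsProbabilityMeasure μ] {f : E → ℝ} (hf : Measurable f) {C : ℝ} (hC : ∀ z, |f z| ≤ C) :
    Integrable f μ ∧ |∫ z, f z ∂μ| ≤ C := by
  refine ⟨Integrable.of_bound hf.aestronglyMeasurable C (ae_of_all _ hC), ?_⟩
  simpa using norm_integral_le_of_norm_le_const (μ := μ) (f := f) (ae_of_all _ hC)

/-- Linearising the Harnack-type inequality at the constant function `1` makes `x ↦ Pf(x)` lower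
semicontinuous for every bounded measurable `f`. -/
lemma lowerSemicontinuous_integral_of_harnack {E : Type*} [TopologicalSpace E] [MeasurableSpace E]
    (P : Kernel E E) [IsMarkovKernel P] {Φ : ℝ → ℝ} (hΦ : ContinuousOn Φ (Set.Ici 0)) {d : ℝ}
    (hd : 0 < d) (hderiv : HasDerivAt Φ d 1) {Ψ : E → E → ℝ} (hΨ0 : ∀ x y, 0 ≤ Ψ x y)
    (hΨ : ∀ x, Tendsto (Ψ x) (nhds x) (nhds 0))
    (hLP : ∀ (x y : E) (f : E → ℝ), Measurable f → (∀ z, 0 ≤ f z) → (∃ C, ∀ z, f z ≤ C) →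
      Φ (∫ z, f z ∂(P x)) ≤ (∫ z, Φ (f z) ∂(P y)) * Real.exp (Ψ x y))
    {f : E → ℝ} (hf : Measurable f) {C : ℝ} (hC0 : 0 < C) (hC : ∀ z, |f z| ≤ C) :
    LowerSemicontinuous fun x => ∫ z, f z ∂(P x) := by
  intro x c hc
  change c < ∫ z, f z ∂(P x) at hc
  set γ := ∫ z, f z ∂(P x) - c with hγ
  have hγ0 : 0 < γ := by linarith
  set η := d * γ / (4 * C) with hη
  have hη0 : 0 < η := by positivity
  have hηC : 4 * (η * C) = d * γ := by rw [hη]; field_simp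
  obtain ⟨δ, hδ0, hδ⟩ := Metric.eventually_nhds_iff.1
    ((hasDerivAt_iff_isLittleO_nhds_zero.1 hderiv).def hη0)
  obtain ⟨ε, hε0, hεδ, hε1⟩ : ∃ ε, 0 < ε ∧ ε * C < δ ∧ ε * C ≤ 1 := by
    refine ⟨min (δ / 2) 1 / C, by positivity, ?_, ?_⟩ <;> rw [div_mul_cancel₀ _ hC0.ne']
    · linarith [min_le_left (δ / 2) 1]
    · exact min_le_right _ _
  have hlin : ∀ t, |t| ≤ C → |Φ (1 + ε * t) - (Φ 1 + d * ε * t)| ≤ η * ε * C := by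
    intro t ht
    have hs : |ε * t| ≤ ε * C := by rw [abs_mul, abs_of_pos hε0]; gcongr
    have h := hδ (y := ε * t) (by simpa [Real.dist_eq] using hs.trans_lt hεδ)
    simp only [smul_eq_mul, Real.norm_eq_abs] at h
    calc _ = |Φ (1 + ε * t) - Φ 1 - ε * t * d| := by congr 1; ring
      _ ≤ η * |ε * t| := h
      _ ≤ η * (ε * C) := by gcongr
      _ = _ := by ring
  have hpos : ∀ z, 0 ≤ 1 + ε * f z := fun z => by
    nlinarith [mul_le_mul_of_nonneg_left (neg_le_of_abs_le (hC z)) hε0.le]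
  have hmeas : Measurable fun z => 1 + ε * f z := by fun_prop
  have hint : ∀ y, Integrable f (P y) ∧ |∫ z, f z ∂(P y)| ≤ C := fun y =>
    integrable_and_abs_integral_le_of_abs_le (P y) hf hC
  have hmean : ∀ y, ∫ z, (1 + ε * f z) ∂(P y) = 1 + ε * ∫ z, f z ∂(P y) := fun y => by
    rw [integral_add (integrable_const _) ((hint y).1.const_mul _), integral_const_mul]; simp
  have hmeanΦ : ∀ y, ∫ z, Φ (1 + ε * f z) ∂(P y) ≤
      Φ 1 + d * ε * ∫ z, f z ∂(P y) + η * ε * C := fun y => by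
    have hg : Integrable (fun z => Φ 1 + d * ε * f z) (P y) :=
      (integrable_const _).add ((hint y).1.const_mul _)
    have hr := integrable_and_abs_integral_le_of_abs_le (P y)
      (f := fun z => Φ (1 + ε * f z) - (Φ 1 + d * ε * f z))
      ((hΦ.measurable_comp_of_nonneg hmeas hpos).sub (by fun_prop)) (fun z => hlin _ (hC z))
    have hsum := integral_add hr.1 hg
    simp only [sub_add_cancel] at hsum
    rw [hsum, integral_add (integrable_const _) ((hint y).1.const_mul _), integral_const_mul]
    simp only [integral_const, probReal_univ, smul_eq_mul, one_mul]
    linarith [le_of_abs_le hr.2]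
  have hexp : Tendsto (fun y => (|Φ 1| + d * ε * C + η * ε * C) * (Real.exp (Ψ x y) - 1))
      (nhds x) (nhds 0) := by
    simpa using (((Real.continuous_exp.tendsto 0).comp (hΨ x)).sub_const 1).const_mul
      (|Φ 1| + d * ε * C + η * ε * C)
  filter_upwards [hexp.eventually_lt_const (show 0 < d * ε * γ / 2 by positivity)] with y hy
  have hbound : ∀ z, 1 + ε * f z ≤ 1 + ε * C := fun z => by
    have := le_of_abs_le (hC z)
    gcongr
  have h := hLP x y _ hmeas hpos ⟨_, hbound⟩
  rw [hmean] at h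
  have hx := neg_le_of_abs_le (hlin _ (hint x).2)
  have hexp1 : 0 ≤ Real.exp (Ψ x y) - 1 := by linarith [Real.one_le_exp (hΨ0 x y)]
  have hup := mul_le_mul_of_nonneg_right (hmeanΦ y) (Real.exp_nonneg (Ψ x y))
  have hbC : Φ 1 + d * ε * ∫ z, f z ∂(P y) + η * ε * C ≤ |Φ 1| + d * ε * C + η * ε * C := by
    have := le_of_abs_le (hint y).2
    gcongr
    exact le_abs_self _
  have hrem := mul_le_mul_of_nonneg_right hbC hexp1
  have hηε : 4 * (η * ε * C) = d * ε * γ := by linear_combination ε * hηC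
  refine lt_of_mul_lt_mul_left (a := d * ε) ?_ (by positivity)
  have hcγ : d * ε * c = d * ε * (∫ z, f z ∂(P x)) - d * ε * γ := by rw [hγ]; ring
  linarith


/-- Under the Harnack-type inequality (LP) with a rate `Ψ` vanishing
continuously on the diagonal, the Markov kernel `P` is strong Feller. -/
theorem stmt_0 {E : Type*} [TopologicalSpace E] [MeasurableSpace E] [BorelSpace E]
    (P : Kernel E E) [IsMarkovKernel P]
    (Φ : ℝ → ℝ)
    (hΦdiff : ContDiffOn ℝ 1 Φ (Set.Ici 0))
    (hΦmono : MonotoneOn Φ (Set.Ici 0))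
    (hΦ'1 : 0 < derivWithin Φ (Set.Ici 0) 1)
    (hΦtop : Tendsto Φ atTop atTop)
    (Ψ : E → E → ℝ) (hΨ0 : ∀ x y, 0 ≤ Ψ x y)
    (hΨcont : ∀ x : E, Tendsto (fun y => Ψ x y + Ψ y x) (nhds x) (nhds 0))
    (hLP : ∀ (x y : E) (f : E → ℝ), Measurable f → (∀ z, 0 ≤ f z) → (∃ C, ∀ z, f z ≤ C) →
      Φ (∫ z, f z ∂(P x)) ≤ (∫ z, Φ (f z) ∂(P y)) * Real.exp (Ψ x y)) :
    ∀ f : E → ℝ, Measurable f → (∃ C, ∀ z, |f z| ≤ C) →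
      Continuous fun x => ∫ z, f z ∂(P x) := by
  rintro f hf ⟨C, hC⟩
  have hΦ := hΦdiff.continuousOn
  have hderiv : HasDerivAt Φ (derivWithin Φ (Set.Ici 0) 1) 1 :=
    ((hΦdiff.differentiableOn one_ne_zero 1 (Set.mem_Ici.2 zero_le_one)).hasDerivWithinAt).hasDerivAt
      (Ici_mem_nhds one_pos)
  have hΨ : ∀ x, Tendsto (Ψ x) (nhds x) (nhds 0) := fun x =>
    squeeze_zero (hΨ0 x) (fun y => le_add_of_nonneg_right (hΨ0 y x)) (hΨcont x)
  have hlsc : ∀ g : E → ℝ, Measurable g → (∀ z, |g z| ≤ C) →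
      LowerSemicontinuous fun x => ∫ z, g z ∂(P x) := fun g hg hgC =>
    lowerSemicontinuous_integral_of_harnack P hΦ hΦ'1 hderiv hΨ0 hΨ hLP hg
      (C := max C 1) (by positivity) fun z => (hgC z).trans (le_max_left _ _)
  refine continuous_iff_lower_upperSemicontinuous.2 ⟨hlsc f hf hC, fun x c hc => ?_⟩
  have hneg := hlsc (fun z => -f z) hf.neg (by simpa using hC) x (-c)
  simpa [integral_neg] using hneg (by simpa [integral_neg] using hc)
end

section
/- Let E be a measurable space, P a Markov kernel on E, and μ a probability measure on E that is quasi-invariant for P. Assume hypothesis (LP) holds. Then for every x ∈ E the measure P(x,·) is absolutely continuous with respect to μ; equivalently, for every measurable set A with μ(A) = 0 one has P(x,A) = 0 for all x ∈ E. -/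
open MeasureTheory ProbabilityTheory Filter

/-- Under (LP), if `μ` is quasi-invariant for the Markov kernel `P`,
then every transition probability `P x` is absolutely continuous w.r.t. `μ`. -/
theorem stmt_1 {E : Type*} [MeasurableSpace E]
    (P : Kernel E E) [IsMarkovKernel P]
    (μ : Measure E) [IsProbabilityMeasure μ]
    (hquasi : (μ.bind fun x => P x) ≪ μ)
    (Φ : ℝ → ℝ)
    (hΦdiff : ContDiffOn ℝ 1 Φ (Set.Ici 0))
    (hΦmono : MonotoneOn Φ (Set.Ici 0))
    (hΦ'1 : 0 < derivWithin Φ (Set.Ici 0) 1)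
    (hΦtop : Tendsto Φ atTop atTop)
    (Ψ : E → E → ℝ) (hΨ0 : ∀ x y, 0 ≤ Ψ x y)
    (hΨmeas : Measurable fun q : E × E => Ψ q.1 q.2)
    (hLP : ∀ (x y : E) (f : E → ℝ), Measurable f → (∀ z, 0 ≤ f z) → (∃ C, ∀ z, f z ≤ C) →
      Φ (∫ z, f z ∂(P x)) ≤ (∫ z, Φ (f z) ∂(P y)) * Real.exp (Ψ x y)) :
    ∀ x : E, P x ≪ μ := by
  intro x
  refine Measure.AbsolutelyContinuous.mk fun A hA hμA => ?_
  have hbind : ∫⁻ y, P y A ∂μ = 0 := by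
    rw [← Measure.bind_apply hA P.measurable.aemeasurable]
    exact hquasi hμA
  obtain ⟨y, hy⟩ : ∃ y, P y A = 0 :=
    ((lintegral_eq_zero_iff (P.measurable_coe hA)).mp hbind).exists
  have hbound (n : ℕ) : Φ (n * (P x).real A) ≤ Φ 0 * Real.exp (Ψ x y) := by
    have h := hLP x y (A.indicator fun _ => (n : ℝ)) (measurable_const.indicator hA)
      (Set.indicator_nonneg fun _ _ => n.cast_nonneg)
      ⟨n, Set.indicator_le_self' (fun _ _ => n.cast_nonneg)⟩
    have hΦ0 : ∫ z, Φ (A.indicator (fun _ => (n : ℝ)) z) ∂(P y) = Φ 0 := by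
      have hae : (fun z => Φ (A.indicator (fun _ => (n : ℝ)) z)) =ᵐ[P y] fun _ => Φ 0 := by
        filter_upwards [measure_eq_zero_iff_ae_notMem.mp hy] with z hz
        rw [Set.indicator_of_notMem hz]
      simp [integral_congr_ae hae]
    rwa [hΦ0, integral_indicator_const _ hA, smul_eq_mul, mul_comm] at h
  by_contra hne
  have hpos : 0 < (P x).real A := measureReal_nonneg.lt_of_ne' (mt (measureReal_eq_zero_iff).mp hne)
  have htop : Tendsto (fun n : ℕ => Φ (n * (P x).real A)) atTop atTop :=
    hΦtop.comp (tendsto_natCast_atTop_atTop.atTop_mul_const hpos)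
  obtain ⟨n, hn⟩ := (htop.eventually_gt_atTop (Φ 0 * Real.exp (Ψ x y))).exists
  exact hn.not_ge (hbound n)
end

section
/- Let E be a standard Borel space, P a Markov kernel on E, and μ a probability measure on E that is quasi-invariant for P. Assume hypothesis (LP) holds. Then P admits a kernel with respect to μ: there exists a jointly measurable function p : E×E → [0,∞) such that for every x ∈ E and every bounded measurable f : E → ℝ, Pf(x) = ∫ p(x,y) f(y) μ(dy). -/
open MeasureTheory ProbabilityTheory Filter

/-- If `Φ` tends to infinity and `Φ (∫ f ∂ρ) ≤ (∫ Φ ∘ f ∂ν) * C` for all bounded measurable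
nonnegative `f`, then `ρ` is absolutely continuous with respect to `ν`. -/
theorem absolutelyContinuous_of_integral_comp_le {E : Type*} [MeasurableSpace E]
    {ρ ν : Measure E} [IsFiniteMeasure ρ] {Φ : ℝ → ℝ} (hΦ : Tendsto Φ atTop atTop) {C : ℝ}
    (h : ∀ f : E → ℝ, Measurable f → (∀ z, 0 ≤ f z) → (∃ K, ∀ z, f z ≤ K) →
      Φ (∫ z, f z ∂ρ) ≤ (∫ z, Φ (f z) ∂ν) * C) : ρ ≪ ν := by
  refine Measure.AbsolutelyContinuous.mk fun A hA hνA => ?_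
  by_contra hρA
  have hpos : 0 < ρ.real A := ENNReal.toReal_pos hρA (measure_ne_top _ _)
  have hle : ∀ t : ℝ, 0 ≤ t → Φ (t * ρ.real A) ≤ (∫ _, Φ 0 ∂ν) * C := by
    intro t ht
    have key := h (A.indicator fun _ => t) (measurable_const.indicator hA)
      (fun z => Set.indicator_nonneg (fun _ _ => ht) z)
      ⟨t, fun z => Set.indicator_le_self' (fun _ _ => ht) z⟩
    have hzero : (fun z => Φ (A.indicator (fun _ => t) z)) =ᵐ[ν] fun _ => Φ 0 := by
      filter_upwards [measure_eq_zero_iff_ae_notMem.1 hνA] with z hz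
      simp [hz]
    rwa [integral_congr_ae hzero, integral_indicator_const t hA, smul_eq_mul, mul_comm] at key
  have hlim := hΦ.comp (tendsto_id.atTop_mul_const hpos)
  obtain ⟨t, ht, ht0⟩ :=
    ((hlim.eventually_gt_atTop ((∫ _, Φ 0 ∂ν) * C)).and (eventually_ge_atTop 0)).exists
  exact (hle t ht0).not_gt ht

/-- Under (LP), if `μ` is quasi-invariant for the Markov kernel `P` on a
standard Borel space, then `P` admits a jointly measurable kernel (density) w.r.t. `μ`. -/
theorem stmt_2 {E : Type*} [MeasurableSpace E] [StandardBorelSpace E]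
    (P : Kernel E E) [IsMarkovKernel P]
    (μ : Measure E) [IsProbabilityMeasure μ]
    (hquasi : (μ.bind fun x => P x) ≪ μ)
    (Φ : ℝ → ℝ)
    (hΦdiff : ContDiffOn ℝ 1 Φ (Set.Ici 0))
    (hΦmono : MonotoneOn Φ (Set.Ici 0))
    (hΦ'1 : 0 < derivWithin Φ (Set.Ici 0) 1)
    (hΦtop : Tendsto Φ atTop atTop)
    (Ψ : E → E → ℝ) (hΨ0 : ∀ x y, 0 ≤ Ψ x y)
    (hΨmeas : Measurable fun q : E × E => Ψ q.1 q.2)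
    (hLP : ∀ (x y : E) (f : E → ℝ), Measurable f → (∀ z, 0 ≤ f z) → (∃ C, ∀ z, f z ≤ C) →
      Φ (∫ z, f z ∂(P x)) ≤ (∫ z, Φ (f z) ∂(P y)) * Real.exp (Ψ x y)) :
    ∃ p : E → E → ℝ, Measurable (Function.uncurry p) ∧ (∀ x y, 0 ≤ p x y) ∧
      ∀ (x : E) (f : E → ℝ), Measurable f → (∃ C, ∀ z, |f z| ≤ C) →
        ∫ z, f z ∂(P x) = ∫ y, p x y * f y ∂μ := by
  have hPP : ∀ x y, P x ≪ P y := fun x y =>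
    absolutelyContinuous_of_integral_comp_le hΦtop (hLP x y)
  have hPμ : ∀ x, P x ≪ μ := by
    refine fun x => Measure.AbsolutelyContinuous.mk fun A hA hμA => ?_
    have hbind := hquasi hμA
    rw [Measure.bind_apply hA P.measurable.aemeasurable,
      lintegral_eq_zero_iff (P.measurable_coe hA)] at hbind
    obtain ⟨y, hy⟩ := hbind.exists
    exact hPP x y hy
  refine ⟨fun x y => (P.rnDeriv (Kernel.const E μ) x y).toReal,
    (Kernel.measurable_rnDeriv P (Kernel.const E μ)).ennreal_toReal,
    fun _ _ => ENNReal.toReal_nonneg, fun x f _ _ => ?_⟩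
  have hae := Kernel.rnDeriv_eq_rnDeriv_measure (κ := P) (η := Kernel.const E μ) (a := x)
  rw [Kernel.const_apply] at hae
  rw [← integral_rnDeriv_smul (hPμ x)]
  refine integral_congr_ae ?_
  filter_upwards [hae] with y hy
  rw [hy, smul_eq_mul]
end

section
/- Let E be a measurable space, P a Markov kernel on E, and μ a probability measure on E that is quasi-invariant for P. Assume hypothesis (LP) holds. Then every invariant probability measure of P is absolutely continuous with respect to μ. -/
open MeasureTheory ProbabilityTheory Filter

/-- A Harnack-type inequality with `Φ → ∞` makes the first measure absolutely continuous
with respect to the second. -/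
theorem absolutelyContinuous_of_integral_le {E : Type*} [MeasurableSpace E]
    {κ η : Measure E} [IsFiniteMeasure κ]
    {Φ : ℝ → ℝ} (hΦtop : Tendsto Φ atTop atTop) {K : ℝ}
    (h : ∀ f : E → ℝ, Measurable f → (∀ z, 0 ≤ f z) → (∃ C, ∀ z, f z ≤ C) →
      Φ (∫ z, f z ∂κ) ≤ (∫ z, Φ (f z) ∂η) * K) :
    κ ≪ η := by
  refine Measure.AbsolutelyContinuous.mk fun A hA hηA => ?_
  by_contra hκA
  have hpos : 0 < κ.real A := ENNReal.toReal_pos hκA (measure_ne_top κ A)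
  have hbound : ∀ c : ℝ, 0 ≤ c → Φ (c * κ.real A) ≤ (∫ _, Φ 0 ∂η) * K := by
    intro c hc
    have hle := h (A.indicator fun _ => c) (measurable_const.indicator hA)
      (fun z => Set.indicator_nonneg (fun _ _ => hc) z)
      ⟨c, fun z => Set.indicator_le_self' (fun _ _ => hc) z⟩
    have hae : ∀ᵐ z ∂η, Φ (A.indicator (fun _ => c) z) = Φ 0 := by
      filter_upwards [measure_eq_zero_iff_ae_notMem.mp hηA] with z hz
      rw [Set.indicator_of_notMem hz]
    rwa [integral_congr_ae hae, integral_indicator_const c hA, smul_eq_mul, mul_comm] at hle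
  obtain ⟨c, hc, hlt⟩ := ((eventually_ge_atTop 0).and
    ((hΦtop.comp (tendsto_id.atTop_mul_const hpos)).eventually_gt_atTop
      ((∫ _, Φ 0 ∂η) * K))).exists
  exact (hbound c hc).not_gt hlt

/-- Under (LP), if `μ` is quasi-invariant for the Markov kernel `P`,
then every invariant probability measure of `P` is absolutely continuous w.r.t. `μ`. -/
theorem stmt_3 {E : Type*} [MeasurableSpace E]
    (P : Kernel E E) [IsMarkovKernel P]
    (μ : Measure E) [IsProbabilityMeasure μ]
    (hquasi : (μ.bind fun x => P x) ≪ μ)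
    (Φ : ℝ → ℝ)
    (hΦdiff : ContDiffOn ℝ 1 Φ (Set.Ici 0))
    (hΦmono : MonotoneOn Φ (Set.Ici 0))
    (hΦ'1 : 0 < derivWithin Φ (Set.Ici 0) 1)
    (hΦtop : Tendsto Φ atTop atTop)
    (Ψ : E → E → ℝ) (hΨ0 : ∀ x y, 0 ≤ Ψ x y)
    (hΨmeas : Measurable fun q : E × E => Ψ q.1 q.2)
    (hLP : ∀ (x y : E) (f : E → ℝ), Measurable f → (∀ z, 0 ≤ f z) → (∃ C, ∀ z, f z ≤ C) →
      Φ (∫ z, f z ∂(P x)) ≤ (∫ z, Φ (f z) ∂(P y)) * Real.exp (Ψ x y)) :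
    ∀ ν : Measure E, IsProbabilityMeasure ν → (ν.bind fun x => P x) = ν → ν ≪ μ := by
  intro ν _ hν
  refine Measure.AbsolutelyContinuous.mk fun A hA hμA => ?_
  have hzero := hquasi hμA
  rw [Measure.bind_apply hA P.measurable.aemeasurable,
    lintegral_eq_zero_iff (P.measurable_coe hA)] at hzero
  obtain ⟨y, hy⟩ := hzero.exists
  rw [← hν, Measure.bind_apply hA P.measurable.aemeasurable]
  have hall : ∀ x, P x A = 0 := fun x =>
    absolutelyContinuous_of_integral_le hΦtop (hLP x y) hy
  simp [hall]
end

section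
/- Let E be a measurable space, P a Markov kernel on E, and μ₀ an invariant probability measure of P. Assume hypothesis (LP) holds. Then the transition probabilities dominate μ₀: for every x ∈ E and every measurable set A, if P(x,A) = 0 then μ₀(A) = 0; equivalently, whenever μ₀(A) > 0 one has P(x,A) > 0 for all x ∈ E. (This expresses the strict positivity of the kernel of P with respect to its invariant measure.) -/
open MeasureTheory ProbabilityTheory Filter

/-- Under (LP), if `μ₀` is an invariant probability measure of the Markov
kernel `P`, then the transition probabilities dominate `μ₀`: a set which is null for
some transition probability `P x` is `μ₀`-null. -/
theorem stmt_4 {E : Type*} [MeasurableSpace E]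
    (P : Kernel E E) [IsMarkovKernel P]
    (μ₀ : Measure E) [IsProbabilityMeasure μ₀]
    (hinv : (μ₀.bind fun x => P x) = μ₀)
    (Φ : ℝ → ℝ)
    (hΦdiff : ContDiffOn ℝ 1 Φ (Set.Ici 0))
    (hΦmono : MonotoneOn Φ (Set.Ici 0))
    (hΦ'1 : 0 < derivWithin Φ (Set.Ici 0) 1)
    (hΦtop : Tendsto Φ atTop atTop)
    (Ψ : E → E → ℝ) (hΨ0 : ∀ x y, 0 ≤ Ψ x y)
    (hΨmeas : Measurable fun q : E × E => Ψ q.1 q.2)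
    (hLP : ∀ (x y : E) (f : E → ℝ), Measurable f → (∀ z, 0 ≤ f z) → (∃ C, ∀ z, f z ≤ C) →
      Φ (∫ z, f z ∂(P x)) ≤ (∫ z, Φ (f z) ∂(P y)) * Real.exp (Ψ x y)) :
    ∀ (x : E) (A : Set E), MeasurableSet A → P x A = 0 → μ₀ A = 0 := by
  intro x A hA hxA
  have key : ∀ y, P y A = 0 := by
    intro y
    by_contra hy
    have hpos : 0 < (P y).real A := ENNReal.toReal_pos hy (measure_ne_top _ _)
    have hlim : Tendsto (fun n : ℕ => Φ (n * (P y).real A)) atTop atTop :=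
      hΦtop.comp (tendsto_natCast_atTop_atTop.atTop_mul_const hpos)
    obtain ⟨n, hn⟩ := (hlim.eventually_gt_atTop (Φ 0 * Real.exp (Ψ y x))).exists
    have hf0 : ∀ z, 0 ≤ A.indicator (fun _ => (n : ℝ)) z := fun z =>
      Set.indicator_nonneg (fun _ _ => n.cast_nonneg) z
    have h := hLP y x (A.indicator fun _ => (n : ℝ)) (measurable_const.indicator hA) hf0
      ⟨n, fun z => Set.indicator_le_self' (fun _ _ => n.cast_nonneg) z⟩
    have hx : ∫ z, Φ (A.indicator (fun _ => (n : ℝ)) z) ∂(P x) = Φ 0 := by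
      have hae : (fun z => Φ (A.indicator (fun _ => (n : ℝ)) z)) =ᵐ[P x] fun _ => Φ 0 := by
        filter_upwards [measure_eq_zero_iff_ae_notMem.1 hxA] with z hz
        rw [Set.indicator_of_notMem hz]
      rw [integral_congr_ae hae]
      simp
    rw [hx, integral_indicator_const _ hA, smul_eq_mul, mul_comm ((P y).real A)] at h
    exact absurd h (not_le.2 hn)
  rw [← hinv, Measure.bind_apply hA P.measurable.aemeasurable]
  simp [key]
end

section
/- Let E be a standard Borel space and P a Markov kernel on E satisfying hypothesis (LP). Then P has at most one invariant probability measure: if ν₀ and ν₁ are probability measures on E with ν₀P = ν₀ and ν₁P = ν₁, then ν₀ = ν₁. -/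
open MeasureTheory ProbabilityTheory Filter

/-- If the measure of a set vanishes for one starting point, then (LP) forces it to vanish for
every starting point. -/
theorem kernel_apply_eq_zero_of_logHarnack {E : Type*} [MeasurableSpace E]
    (P : Kernel E E) [IsMarkovKernel P] (Φ : ℝ → ℝ) (hΦtop : Tendsto Φ atTop atTop)
    (Ψ : E → E → ℝ)
    (hLP : ∀ (x y : E) (f : E → ℝ), Measurable f → (∀ z, 0 ≤ f z) → (∃ C, ∀ z, f z ≤ C) →
      Φ (∫ z, f z ∂(P x)) ≤ (∫ z, Φ (f z) ∂(P y)) * Real.exp (Ψ x y))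
    {A : Set E} (hA : MeasurableSet A) {y : E} (hy : P y A = 0) (x : E) : P x A = 0 := by
  by_contra hx
  have hpos : 0 < (P x).real A := by
    rw [measureReal_def]
    exact ENNReal.toReal_pos hx (measure_ne_top _ _)
  have hbound : ∀ c : ℝ, 0 ≤ c → Φ ((P x).real A * c) ≤ Φ 0 * Real.exp (Ψ x y) := by
    intro c hc
    have h := hLP x y (A.indicator fun _ => c) (measurable_const.indicator hA)
      (fun z => Set.indicator_nonneg (fun _ _ => hc) z)
      ⟨c, fun z => Set.indicator_le_self' (fun _ _ => hc) z⟩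
    have hae : (fun z => Φ (A.indicator (fun _ => c) z)) =ᵐ[P y] fun _ => Φ 0 := by
      filter_upwards [measure_eq_zero_iff_ae_notMem.1 hy] with z hz
      rw [Set.indicator_of_notMem hz]
    rw [integral_congr_ae hae, integral_indicator_const _ hA] at h
    simpa using h
  have hlim : Tendsto (fun c : ℝ => Φ ((P x).real A * c)) atTop atTop :=
    hΦtop.comp (tendsto_id.const_mul_atTop hpos)
  obtain ⟨c, hc, hc0⟩ := ((hlim.eventually_gt_atTop _).and (eventually_ge_atTop 0)).exists
  exact absurd (hbound c hc0) (not_le.2 hc)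

/-- Two finite measures decompose as a common part plus two pieces carried by complementary sets. -/
theorem exists_eq_add_eq_add_of_isFiniteMeasure {E : Type*} [MeasurableSpace E]
    (μ ν : Measure E) [IsFiniteMeasure μ] [IsFiniteMeasure ν] :
    ∃ (A : Set E) (m ρ σ : Measure E), MeasurableSet A ∧ μ = ρ + m ∧ ν = σ + m ∧
      ρ Aᶜ = 0 ∧ σ A = 0 := by
  obtain ⟨A, hA, h₁, h₂⟩ := hahn_decomposition μ ν
  have hle₁ : ν.restrict A ≤ μ.restrict A := Measure.le_iff.2 fun t ht => by
    simpa only [Measure.restrict_apply ht] using h₁ _ (ht.inter hA) Set.inter_subset_right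
  have hle₂ : μ.restrict Aᶜ ≤ ν.restrict Aᶜ := Measure.le_iff.2 fun t ht => by
    simpa only [Measure.restrict_apply ht] using h₂ _ (ht.inter hA.compl) Set.inter_subset_right
  refine ⟨A, ν.restrict A + μ.restrict Aᶜ, μ.restrict A - ν.restrict A,
    ν.restrict Aᶜ - μ.restrict Aᶜ, hA, ?_, ?_, ?_, ?_⟩
  · rw [← add_assoc, Measure.sub_add_cancel_of_le hle₁, Measure.restrict_add_restrict_compl hA]
  · rw [add_comm (ν.restrict A), ← add_assoc, Measure.sub_add_cancel_of_le hle₂, add_comm,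
      Measure.restrict_add_restrict_compl hA]
  · exact le_antisymm ((Measure.sub_le Aᶜ).trans_eq (by simp [Measure.restrict_apply hA.compl]))
      bot_le
  · exact le_antisymm ((Measure.sub_le A).trans_eq (by simp [Measure.restrict_apply hA])) bot_le

/-- A Markov kernel whose transition probabilities are mutually absolutely continuous has at most
one invariant probability measure. -/
theorem eq_of_bind_eq_of_kernel_absolutelyContinuous {E : Type*} [MeasurableSpace E]
    (P : Kernel E E) [IsMarkovKernel P]
    (hP : ∀ A, MeasurableSet A → ∀ y, P y A = 0 → ∀ x, P x A = 0)
    (μ ν : Measure E) [IsProbabilityMeasure μ] [IsProbabilityMeasure ν]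
    (hμ : (μ.bind fun x => P x) = μ) (hν : (ν.bind fun x => P x) = ν) : μ = ν := by
  obtain ⟨A, m, ρ, σ, hA, hμ', hν', hρ, hσ⟩ := exists_eq_add_eq_add_of_isFiniteMeasure μ ν
  have hg : Measurable fun x => P x A := P.measurable_coe hA
  have hm : IsFiniteMeasure m :=
    isFiniteMeasure_of_le ν (hν'.symm ▸ Measure.le_add_left le_rfl)
  have hmass : ρ Set.univ = σ Set.univ := by
    have h : (ρ + m) Set.univ = (σ + m) Set.univ := by
      rw [← hμ', ← hν', measure_univ, measure_univ]
    exact (ENNReal.add_left_inj (measure_ne_top m _)).1 h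
  have hρA : ρ Set.univ = ρ A := by rw [← measure_add_measure_compl hA, hρ, add_zero]
  have hinvμ : ∫⁻ x, P x A ∂ρ + ∫⁻ x, P x A ∂m = ρ A + m A := by
    have h := congrArg (fun τ : Measure E => τ A) hμ
    simp only [Measure.bind_apply hA P.measurable.aemeasurable] at h
    rwa [hμ', lintegral_add_measure, Measure.add_apply] at h
  have hinvν : ∫⁻ x, P x A ∂σ + ∫⁻ x, P x A ∂m = m A := by
    have h := congrArg (fun τ : Measure E => τ A) hν
    simp only [Measure.bind_apply hA P.measurable.aemeasurable] at h
    rwa [hν', lintegral_add_measure, Measure.add_apply, hσ, zero_add] at h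
  have hmfin : ∫⁻ x, P x A ∂m ≠ ⊤ :=
    ne_top_of_le_ne_top (measure_ne_top m A) (hinvν ▸ le_add_self)
  have hbal : ∫⁻ x, P x A ∂ρ = ρ A + ∫⁻ x, P x A ∂σ := by
    rw [← hinvν, ← add_assoc] at hinvμ
    exact (ENNReal.add_left_inj hmfin).1 hinvμ
  have hρfin : ρ A ≠ ⊤ := by
    refine ne_top_of_le_ne_top (measure_ne_top μ A) ?_
    rw [hμ', Measure.add_apply]
    exact le_self_add
  have hle : ∫⁻ x, P x A ∂ρ ≤ ρ A := by
    calc ∫⁻ x, P x A ∂ρ ≤ ∫⁻ _, 1 ∂ρ := lintegral_mono fun x => prob_le_one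
      _ = ρ A := by rw [lintegral_one, hρA]
  have hσint : ∫⁻ x, P x A ∂σ = 0 := by
    rw [hbal] at hle
    exact nonpos_iff_eq_zero.1
      ((ENNReal.add_le_add_iff_left hρfin).1 (hle.trans_eq (add_zero _).symm))
  have hσ0 : σ = 0 := by
    by_contra hne
    have : (ae σ).NeBot := ae_neBot.2 hne
    obtain ⟨y, hy⟩ := ((lintegral_eq_zero_iff hg).1 hσint).exists
    have hzero : ∀ x, P x A = 0 := hP A hA y hy
    simp only [hzero, lintegral_zero, add_zero] at hbal
    exact hne (Measure.measure_univ_eq_zero.1 (by rw [← hmass, hρA, ← hbal]))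
  have hρ0 : ρ = 0 := Measure.measure_univ_eq_zero.1 (by simp [hmass, hσ0])
  rw [hμ', hν', hσ0, hρ0]

/-- Under (LP), a Markov kernel on a standard Borel space has at most one
invariant probability measure. -/
theorem stmt_5 {E : Type*} [MeasurableSpace E] [StandardBorelSpace E]
    (P : Kernel E E) [IsMarkovKernel P]
    (Φ : ℝ → ℝ)
    (hΦdiff : ContDiffOn ℝ 1 Φ (Set.Ici 0))
    (hΦmono : MonotoneOn Φ (Set.Ici 0))
    (hΦ'1 : 0 < derivWithin Φ (Set.Ici 0) 1)
    (hΦtop : Tendsto Φ atTop atTop)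
    (Ψ : E → E → ℝ) (hΨ0 : ∀ x y, 0 ≤ Ψ x y)
    (hΨmeas : Measurable fun q : E × E => Ψ q.1 q.2)
    (hLP : ∀ (x y : E) (f : E → ℝ), Measurable f → (∀ z, 0 ≤ f z) → (∃ C, ∀ z, f z ≤ C) →
      Φ (∫ z, f z ∂(P x)) ≤ (∫ z, Φ (f z) ∂(P y)) * Real.exp (Ψ x y))
    (ν₀ ν₁ : Measure E) (hν₀ : IsProbabilityMeasure ν₀) (hν₁ : IsProbabilityMeasure ν₁)
    (hinv₀ : (ν₀.bind fun x => P x) = ν₀) (hinv₁ : (ν₁.bind fun x => P x) = ν₁) :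
    ν₀ = ν₁ := by
  exact eq_of_bind_eq_of_kernel_absolutelyContinuous P
    (fun _ hA _ hy x => kernel_apply_eq_zero_of_logHarnack P Φ hΦtop Ψ hLP hA hy x)
    ν₀ ν₁ hinv₀ hinv₁
end

section
/- Let E be a measurable space and P a Markov kernel on E satisfying the log-Harnack inequality with rate Ψ : E×E → [0,∞). Then for all x, y ∈ E the probability measure P(x,·) is absolutely continuous with respect to P(y,·) and the Kullback–Leibler divergence satisfies KL(P(x,·) ‖ P(y,·)) ≤ Ψ(x,y). -/
open MeasureTheory ProbabilityTheory Filter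
open scoped ENNReal NNReal Classical

/-- The Kullback–Leibler divergence `KL(ν ‖ ν') = ∫ log (dν/dν') dν`, taken to be `∞`
if `ν` is not absolutely continuous w.r.t. `ν'` or the log-likelihood ratio is not
`ν`-integrable. -/

noncomputable def klDiv {E : Type*} [MeasurableSpace E] (ν ν' : Measure E) : ℝ≥0∞ :=
  if ν ≪ ν' ∧ Integrable (llr ν ν') ν
  then ENNReal.ofReal (∫ x, llr ν ν' x ∂ν) else ⊤

/-- The log-Harnack bound with constant `C` between two measures: the Donsker–Varadhan
inequality for `log f`, where `f ≥ 1` is bounded and measurable. -/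
def LogHarnackBound {E : Type*} [MeasurableSpace E] (μ ν : Measure E) (C : ℝ) : Prop :=
  ∀ f : E → ℝ, Measurable f → (∀ z, 1 ≤ f z) → (∃ K, ∀ z, f z ≤ K) →
    ∫ z, Real.log (f z) ∂μ ≤ Real.log (∫ z, f z ∂ν) + C

namespace LogHarnackBound

variable {E : Type*} [MeasurableSpace E] {μ ν : Measure E} {C : ℝ}

lemma integrable_of_mem_Icc [IsFiniteMeasure μ] {g : E → ℝ} {a b : ℝ} (hg : Measurable g)
    (hgab : ∀ z, g z ∈ Set.Icc a b) : Integrable g μ :=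
  .of_mem_Icc a b hg.aemeasurable (ae_of_all _ hgab)

lemma integrable_log_of_mem_Icc [IsFiniteMeasure μ] {g : E → ℝ} {a b : ℝ} (ha : 0 < a)
    (hg : Measurable g) (hgab : ∀ z, g z ∈ Set.Icc a b) :
    Integrable (fun z ↦ Real.log (g z)) μ :=
  integrable_of_mem_Icc hg.log fun z ↦
    ⟨Real.log_le_log ha (hgab z).1, Real.log_le_log (ha.trans_le (hgab z).1) (hgab z).2⟩

/-- By scaling, the bound extends to functions bounded below by any positive constant. -/
lemma integral_log_le [IsProbabilityMeasure μ] [IsProbabilityMeasure ν]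
    (h : LogHarnackBound μ ν C) {g : E → ℝ} {a b : ℝ} (ha : 0 < a) (hg : Measurable g)
    (hgab : ∀ z, g z ∈ Set.Icc a b) :
    ∫ z, Real.log (g z) ∂μ ≤ Real.log (∫ z, g z ∂ν) + C := by
  have hpos (z : E) : 0 < g z := ha.trans_le (hgab z).1
  have key := h (fun z ↦ g z / a) (hg.div_const a) (fun z ↦ (one_le_div ha).2 (hgab z).1)
    ⟨b / a, fun z ↦ div_le_div_of_nonneg_right (hgab z).2 ha.le⟩
  have hint : a ≤ ∫ z, g z ∂ν := by
    simpa using integral_mono (integrable_const a) (integrable_of_mem_Icc (μ := ν) hg hgab)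
      fun z ↦ (hgab z).1
  simp_rw [Real.log_div (hpos _).ne' ha.ne'] at key
  rw [integral_sub (integrable_log_of_mem_Icc ha hg hgab) (integrable_const _),
    integral_div, Real.log_div (ha.trans_le hint).ne' ha.ne'] at key
  simp only [integral_const, probReal_univ, one_smul] at key
  linarith

lemma absolutelyContinuous [IsFiniteMeasure μ] [IsProbabilityMeasure ν]
    (h : LogHarnackBound μ ν C) : μ ≪ ν := by
  refine Measure.AbsolutelyContinuous.mk fun s hs hνs ↦ ?_
  have hbound (t : ℝ) (ht : 0 ≤ t) : t * μ.real s ≤ C := by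
    have hone : 1 ≤ Real.exp t := Real.one_le_exp ht
    have key := h (s.piecewise (fun _ ↦ Real.exp t) (fun _ ↦ 1))
      (Measurable.piecewise hs measurable_const measurable_const)
      (fun z ↦ by by_cases hz : z ∈ s <;> simp [hz, ht])
      ⟨Real.exp t, fun z ↦ by by_cases hz : z ∈ s <;> simp [hz, ht]⟩
    have hlog : (fun z ↦ Real.log (s.piecewise (fun _ ↦ Real.exp t) (fun _ ↦ 1) z)) =
        s.indicator fun _ ↦ t := by
      ext z
      by_cases hz : z ∈ s <;> simp [hz]
    have hν : s.piecewise (fun _ ↦ Real.exp t) (fun _ ↦ 1) =ᵐ[ν] fun _ ↦ (1 : ℝ) := by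
      filter_upwards [measure_eq_zero_iff_ae_notMem.1 hνs] with z hz
      simp [hz]
    rw [hlog, integral_indicator_const _ hs, integral_congr_ae hν] at key
    simpa [mul_comm] using key
  by_contra hne
  have hpos : 0 < μ.real s := ENNReal.toReal_pos hne (measure_ne_top _ _)
  have := hbound ((|C| + 1) / μ.real s) (by positivity)
  rw [div_mul_cancel₀ _ hpos.ne'] at this
  linarith [le_abs_self C]

lemma integrable_posLog_rnDeriv [IsProbabilityMeasure μ] [IsProbabilityMeasure ν]
    (h : LogHarnackBound μ ν C) :
    Integrable (fun z ↦ Real.posLog (μ.rnDeriv ν z).toReal) μ := by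
  set r : E → ℝ := fun z ↦ (μ.rnDeriv ν z).toReal
  have hr : Measurable r := (Measure.measurable_rnDeriv μ ν).ennreal_toReal
  have hr0 (z : E) : 0 ≤ r z := ENNReal.toReal_nonneg
  let g (n : ℕ) (z : E) : ℝ := min (max 1 (r z)) (n + 1)
  have hg (n : ℕ) : Measurable (g n) := (measurable_const.max hr).min measurable_const
  have hgab (n : ℕ) (z : E) : g n z ∈ Set.Icc 1 (n + 1 : ℝ) :=
    ⟨le_min (le_max_left _ _) (by simp), min_le_right _ _⟩
  set K : ℝ := Real.log (∫ z, max 1 (r z) ∂ν) + C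
  have hmax : Integrable (fun z ↦ max 1 (r z)) ν :=
    (integrable_const 1).sup Measure.integrable_toReal_rnDeriv
  have hK (n : ℕ) : ∫ z, Real.log (g n z) ∂μ ≤ K := by
    refine (h.integral_log_le one_pos (hg n) (hgab n)).trans ?_
    have hone : 1 ≤ ∫ z, g n z ∂ν := by
      simpa using integral_mono (integrable_const 1)
        (integrable_of_mem_Icc (μ := ν) (hg n) (hgab n)) fun z ↦ (hgab n z).1
    have hle : ∫ z, g n z ∂ν ≤ ∫ z, max 1 (r z) ∂ν :=
      integral_mono (integrable_of_mem_Icc (hg n) (hgab n)) hmax fun z ↦ min_le_left _ _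
    exact add_le_add_left (Real.log_le_log (one_pos.trans_le hone) hle) C
  have hlim : Tendsto (fun n ↦ ∫⁻ z, ENNReal.ofReal (Real.log (g n z)) ∂μ) atTop
      (nhds (∫⁻ z, ENNReal.ofReal (Real.posLog (r z)) ∂μ)) := by
    refine lintegral_tendsto_of_tendsto_of_monotone
      (fun n ↦ (hg n).log.ennreal_ofReal.aemeasurable) (ae_of_all _ fun z m n hmn ↦ ?_)
      (ae_of_all _ fun z ↦ ?_)
    · refine ENNReal.ofReal_le_ofReal (Real.log_le_log (one_pos.trans_le (hgab m z).1) ?_)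
      exact min_le_min_left _ (by gcongr)
    · obtain ⟨N, hN⟩ := exists_nat_ge (max 1 (r z))
      refine tendsto_const_nhds.congr' ?_
      filter_upwards [eventually_ge_atTop N] with n hn
      have : (N : ℝ) ≤ n := by exact_mod_cast hn
      rw [Real.posLog_eq_log_max_one (hr0 z)]
      simp only [g]
      rw [min_eq_left (by linarith)]
  have hfin : ∫⁻ z, ENNReal.ofReal (Real.posLog (r z)) ∂μ ≤ ENNReal.ofReal K := by
    refine le_of_tendsto' hlim fun n ↦ ?_
    rw [← ofReal_integral_eq_lintegral_ofReal
      (integrable_log_of_mem_Icc one_pos (hg n) (hgab n))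
      (ae_of_all _ fun z ↦ Real.log_nonneg (hgab n z).1)]
    exact ENNReal.ofReal_le_ofReal (hK n)
  refine ⟨(Real.continuous_posLog.measurable.comp hr).aestronglyMeasurable, ?_⟩
  rw [hasFiniteIntegral_iff_ofReal (ae_of_all _ fun _ ↦ Real.posLog_nonneg)]
  exact hfin.trans_lt ENNReal.ofReal_lt_top

/-- The negative part of the log-likelihood ratio is always integrable. -/
lemma integrable_posLog_inv_rnDeriv [IsFiniteMeasure μ] [IsFiniteMeasure ν] (hμν : μ ≪ ν) :
    Integrable (fun z ↦ Real.posLog (μ.rnDeriv ν z).toReal⁻¹) μ := by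
  have hr : Measurable fun z ↦ (μ.rnDeriv ν z).toReal :=
    (Measure.measurable_rnDeriv μ ν).ennreal_toReal
  rw [← integrable_rnDeriv_smul_iff hμν]
  refine integrable_of_mem_Icc (a := 0) (b := 1)
    (hr.smul (Real.continuous_posLog.measurable.comp hr.inv)) fun z ↦ ?_
  have h0 : 0 ≤ (μ.rnDeriv ν z).toReal := ENNReal.toReal_nonneg
  refine ⟨mul_nonneg h0 Real.posLog_nonneg, ?_⟩
  calc (μ.rnDeriv ν z).toReal * Real.posLog (μ.rnDeriv ν z).toReal⁻¹
      ≤ (μ.rnDeriv ν z).toReal * (μ.rnDeriv ν z).toReal⁻¹ := by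
        refine mul_le_mul_of_nonneg_left ?_ h0
        exact max_le (inv_nonneg.2 h0) (Real.log_le_self (inv_nonneg.2 h0))
    _ ≤ 1 := mul_inv_le_one

lemma integrable_llr [IsProbabilityMeasure μ] [IsProbabilityMeasure ν]
    (h : LogHarnackBound μ ν C) : Integrable (llr μ ν) μ :=
  (h.integrable_posLog_rnDeriv.sub (integrable_posLog_inv_rnDeriv h.absolutelyContinuous)).congr
    (ae_of_all _ fun _ ↦ Real.posLog_sub_posLog_inv)

lemma abs_log_max_min_le {r b : ℝ} (hr : 0 < r) (hb : 1 ≤ b) :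
    |Real.log (max b⁻¹ (min r b))| ≤ |Real.log r| := by
  have hb0 : 0 < b := one_pos.trans_le hb
  have hlogb : 0 ≤ Real.log b := Real.log_nonneg hb
  rcases le_total r b with hrb | hbr
  · rw [min_eq_left hrb]
    rcases le_total r b⁻¹ with hle | hge
    · rw [max_eq_left hle, Real.log_inv, abs_neg, abs_of_nonneg hlogb]
      have := Real.log_le_log hr hle
      rw [Real.log_inv] at this
      linarith [neg_le_abs (Real.log r)]
    · rw [max_eq_right hge]
  · rw [min_eq_right hbr, max_eq_right ((inv_le_one_of_one_le₀ hb).trans hb),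
      abs_of_nonneg hlogb]
    exact (Real.log_le_log hb0 hbr).trans (le_abs_self _)

lemma integral_llr_le [IsProbabilityMeasure μ] [IsProbabilityMeasure ν]
    (h : LogHarnackBound μ ν C) : ∫ z, llr μ ν z ∂μ ≤ C := by
  have hac := h.absolutelyContinuous
  set r : E → ℝ := fun z ↦ (μ.rnDeriv ν z).toReal
  have hr : Measurable r := (Measure.measurable_rnDeriv μ ν).ennreal_toReal
  have hr0 (z : E) : 0 ≤ r z := ENNReal.toReal_nonneg
  have hr_pos : ∀ᵐ z ∂μ, 0 < r z := by
    filter_upwards [Measure.rnDeriv_pos hac, hac.ae_le (Measure.rnDeriv_lt_top μ ν)]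
      with z hz hz' using ENNReal.toReal_pos hz.ne' hz'.ne
  let b (n : ℕ) : ℝ := n + 1
  have hb (n : ℕ) : 1 ≤ b n := by simp [b]
  have hb0 (n : ℕ) : 0 < b n := one_pos.trans_le (hb n)
  let g (n : ℕ) (z : E) : ℝ := max (b n)⁻¹ (min (r z) (b n))
  have hg (n : ℕ) : Measurable (g n) := measurable_const.max (hr.min measurable_const)
  have hgab (n : ℕ) (z : E) : g n z ∈ Set.Icc (b n)⁻¹ (b n) :=
    ⟨le_max_left _ _, max_le ((inv_le_one_of_one_le₀ (hb n)).trans (hb n)) (min_le_right _ _)⟩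
  have hbound (n : ℕ) : ∫ z, Real.log (g n z) ∂μ ≤ (b n)⁻¹ + C := by
    refine (h.integral_log_le (inv_pos.2 (hb0 n)) (hg n) (hgab n)).trans ?_
    have hge : (b n)⁻¹ ≤ ∫ z, g n z ∂ν := by
      simpa using integral_mono (integrable_const (b n)⁻¹)
        (integrable_of_mem_Icc (μ := ν) (hg n) (hgab n)) fun z ↦ (hgab n z).1
    have hle : ∫ z, g n z ∂ν ≤ (b n)⁻¹ + 1 := by
      have hr1 : ∫ z, r z ∂ν = 1 := by
        simpa using Measure.integral_toReal_rnDeriv hac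
      calc ∫ z, g n z ∂ν ≤ ∫ z, ((b n)⁻¹ + r z) ∂ν := by
            refine integral_mono (integrable_of_mem_Icc (hg n) (hgab n))
              ((integrable_const _).add Measure.integrable_toReal_rnDeriv) fun z ↦ ?_
            have := inv_pos.2 (hb0 n)
            exact max_le (by linarith [hr0 z]) ((min_le_left _ _).trans (by linarith))
        _ = (b n)⁻¹ + 1 := by
            rw [integral_add (integrable_const _) Measure.integrable_toReal_rnDeriv, hr1]
            simp
    have := Real.log_le_sub_one_of_pos ((inv_pos.2 (hb0 n)).trans_le hge)
    linarith
  have hb_lim : Tendsto b atTop atTop :=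
    tendsto_atTop_add_const_right _ _ tendsto_natCast_atTop_atTop
  have hlim : Tendsto (fun n ↦ ∫ z, Real.log (g n z) ∂μ) atTop (nhds (∫ z, llr μ ν z ∂μ)) := by
    refine tendsto_integral_of_dominated_convergence (fun z ↦ |llr μ ν z|)
      (fun n ↦ (hg n).log.aestronglyMeasurable) h.integrable_llr.abs (fun n ↦ ?_) ?_
    · filter_upwards [hr_pos] with z hz using abs_log_max_min_le hz (hb n)
    · filter_upwards [hr_pos] with z hz
      refine tendsto_const_nhds.congr' ?_
      filter_upwards [hb_lim.eventually_ge_atTop (r z), hb_lim.eventually_ge_atTop (r z)⁻¹]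
        with n hn hn'
      simp only [g]
      rw [min_eq_left hn, max_eq_right (inv_le_of_inv_le₀ hz hn'), llr_def]
  have hlim' : Tendsto (fun n ↦ (b n)⁻¹ + C) atTop (nhds C) := by
    simpa using hb_lim.inv_tendsto_atTop.add_const C
  exact le_of_tendsto_of_tendsto' hlim hlim' hbound

end LogHarnackBound

/-- If a Markov kernel `P` satisfies the log-Harnack inequality with rate
`Ψ`, then `P x ≪ P y` with `KL(P x ‖ P y) ≤ Ψ x y` for all `x, y`. -/
theorem stmt_6 {E : Type*} [MeasurableSpace E]
    (P : Kernel E E) [IsMarkovKernel P]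
    (Ψ : E → E → ℝ) (hΨ0 : ∀ x y, 0 ≤ Ψ x y)
    (hLH : ∀ (f : E → ℝ), Measurable f → (∀ z, 1 ≤ f z) → (∃ C, ∀ z, f z ≤ C) →
      ∀ x y : E, ∫ z, Real.log (f z) ∂(P x) ≤ Real.log (∫ z, f z ∂(P y)) + Ψ x y) :
    ∀ x y : E, P x ≪ P y ∧ klDiv (P x) (P y) ≤ ENNReal.ofReal (Ψ x y) := by
  intro x y
  have h : LogHarnackBound (P x) (P y) (Ψ x y) := fun f hf h1 hb ↦ hLH f hf h1 hb x y
  refine ⟨h.absolutelyContinuous, ?_⟩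
  rw [klDiv, if_pos ⟨h.absolutelyContinuous, h.integrable_llr⟩]
  exact ENNReal.ofReal_le_ofReal h.integral_llr_le
end

section
/- Let E be a measurable space, P a Markov kernel on E satisfying the log-Harnack inequality with rate Ψ : E×E → [0,∞), and μ a probability measure on E. Suppose x, y ∈ E and p_x, p_y : E → [0,∞) are measurable densities of P(x,·) and P(y,·) with respect to μ, i.e. P(x,A) = ∫_A p_x dμ and P(y,A) = ∫_A p_y dμ for every measurable A. Then ∫_E p_x(z) p_y(z) μ(dz) ≥ exp(−Ψ(x,y)). -/
open MeasureTheory ProbabilityTheory Filter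

/-- A truncation of a probability density `p` has almost nonnegative `log`-integral against
`p • μ`: the reverse bound `log t ≥ 1 - 1 / t` replaces the nonnegativity of the entropy. -/
theorem neg_le_integral_log_truncation {E : Type*} [MeasurableSpace E]
    {μ ν : Measure E} [IsProbabilityMeasure μ] [IsProbabilityMeasure ν] {p : E → ℝ}
    (hp : Measurable p) (hp0 : ∀ z, 0 ≤ p z)
    (hν : ν = μ.withDensity fun z => ENNReal.ofReal (p z)) {δ : ℝ} (hδ : 0 < δ) :
    -δ ≤ ∫ z, Real.log (max δ (min (p z) δ⁻¹)) ∂ν := by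
  set f : E → ℝ := fun z => max δ (min (p z) δ⁻¹) with hf
  have hfm : Measurable f := measurable_const.max (hp.min measurable_const)
  have hfδ : ∀ z, δ ≤ f z := fun z => le_max_left _ _
  have hf0 : ∀ z, 0 < f z := fun z => hδ.trans_le (hfδ z)
  have hfC : ∀ z, f z ≤ max δ δ⁻¹ := fun z => max_le_max le_rfl (min_le_right _ _)
  have hfim : Measurable fun z => (f z)⁻¹ := hfm.inv
  have hinv : Integrable (fun z => (f z)⁻¹) ν := by
    refine Integrable.of_bound hfim.aestronglyMeasurable δ⁻¹ (ae_of_all _ fun z => ?_)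
    rw [Real.norm_of_nonneg (inv_nonneg.2 (hf0 z).le)]
    exact inv_anti₀ hδ (hfδ z)
  have hlog : Integrable (fun z => Real.log (f z)) ν :=
    Integrable.of_mem_Icc (Real.log δ) (Real.log (max δ δ⁻¹)) hfm.log.aemeasurable
      (ae_of_all _ fun z =>
        ⟨Real.log_le_log hδ (hfδ z), Real.log_le_log (hf0 z) (hfC z)⟩)
  have hpt : ∀ z, p z * (f z)⁻¹ ≤ 1 + p z * δ := by
    intro z
    rcases le_total (p z) δ⁻¹ with h | h
    · have h1 : p z ≤ f z := (le_min le_rfl h).trans (le_max_right _ _)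
      have h2 : p z * (f z)⁻¹ ≤ 1 := by
        rw [← div_eq_mul_inv]
        exact (div_le_one (hf0 z)).2 h1
      have := mul_nonneg (hp0 z) hδ.le
      linarith
    · have h1 : δ⁻¹ ≤ f z := (le_min h le_rfl).trans (le_max_right _ _)
      have h2 : p z * (f z)⁻¹ ≤ p z * δ :=
        mul_le_mul_of_nonneg_left (inv_le_of_inv_le₀ hδ h1) (hp0 z)
      linarith
  have hpν : ∫⁻ z, ENNReal.ofReal (p z) ∂μ = 1 := by
    have h : ν Set.univ = 1 := measure_univ
    rwa [hν, withDensity_apply _ MeasurableSet.univ, Measure.restrict_univ] at h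
  have hbound : ∫ z, (f z)⁻¹ ∂ν ≤ 1 + δ := by
    rw [← ENNReal.ofReal_le_ofReal_iff (by positivity),
      ofReal_integral_eq_lintegral_ofReal hinv
        (ae_of_all _ fun z => inv_nonneg.2 (hf0 z).le), hν,
      lintegral_withDensity_eq_lintegral_mul _ hp.ennreal_ofReal hfim.ennreal_ofReal]
    calc ∫⁻ z, ((fun z => ENNReal.ofReal (p z)) * fun z => ENNReal.ofReal (f z)⁻¹) z ∂μ
        ≤ ∫⁻ z, (1 + ENNReal.ofReal (p z) * ENNReal.ofReal δ) ∂μ := by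
          refine lintegral_mono fun z => ?_
          rw [Pi.mul_apply, ← ENNReal.ofReal_mul (hp0 z), ← ENNReal.ofReal_mul (hp0 z),
            ← ENNReal.ofReal_one, ← ENNReal.ofReal_add zero_le_one (mul_nonneg (hp0 z) hδ.le)]
          exact ENNReal.ofReal_le_ofReal (hpt z)
      _ = ENNReal.ofReal (1 + δ) := by
          rw [lintegral_add_left measurable_const, lintegral_mul_const _ hp.ennreal_ofReal, hpν,
            ENNReal.ofReal_add zero_le_one hδ.le]
          simp
  calc -δ ≤ 1 - ∫ z, (f z)⁻¹ ∂ν := by linarith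
    _ = ∫ z, (1 - (f z)⁻¹) ∂ν := by
        rw [integral_sub (integrable_const _) hinv]
        simp
    _ ≤ ∫ z, Real.log (f z) ∂ν :=
        integral_mono ((integrable_const _).sub hinv) hlog fun z =>
          Real.one_sub_inv_le_log_of_pos (hf0 z)

/-- If a Markov kernel `P` satisfies the log-Harnack inequality with rate
`Ψ`, and `P x, P y` have densities `px, py` w.r.t. a probability measure `μ`, then
`∫ px · py dμ ≥ exp (-Ψ x y)`. -/
theorem stmt_7 {E : Type*} [MeasurableSpace E]
    (P : Kernel E E) [IsMarkovKernel P]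
    (Ψ : E → E → ℝ) (hΨ0 : ∀ x' y', 0 ≤ Ψ x' y')
    (hLH : ∀ (f : E → ℝ), Measurable f → (∀ z, 1 ≤ f z) → (∃ C, ∀ z, f z ≤ C) →
      ∀ x' y' : E, ∫ z, Real.log (f z) ∂(P x') ≤ Real.log (∫ z, f z ∂(P y')) + Ψ x' y')
    (μ : Measure E) [IsProbabilityMeasure μ]
    (x y : E) (px py : E → ℝ)
    (hpxm : Measurable px) (hpym : Measurable py)
    (hpx0 : ∀ z, 0 ≤ px z) (hpy0 : ∀ z, 0 ≤ py z)
    (hpx : ∀ A : Set E, MeasurableSet A → P x A = ∫⁻ z in A, ENNReal.ofReal (px z) ∂μ)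
    (hpy : ∀ A : Set E, MeasurableSet A → P y A = ∫⁻ z in A, ENNReal.ofReal (py z) ∂μ) :
    ENNReal.ofReal (Real.exp (-(Ψ x y))) ≤
      ∫⁻ z, ENNReal.ofReal (px z) * ENNReal.ofReal (py z) ∂μ := by
  have hPx : P x = μ.withDensity fun z => ENNReal.ofReal (px z) :=
    Measure.ext fun A hA => by rw [hpx A hA, withDensity_apply _ hA]
  have hPy : P y = μ.withDensity fun z => ENNReal.ofReal (py z) :=
    Measure.ext fun A hA => by rw [hpy A hA, withDensity_apply _ hA]
  set I := ∫⁻ z, ENNReal.ofReal (px z) * ENNReal.ofReal (py z) ∂μ with hI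
  have key : ∀ δ : ℝ, 0 < δ →
      ENNReal.ofReal (Real.exp (-δ - Ψ x y)) ≤ I + ENNReal.ofReal δ := by
    intro δ hδ
    set f : E → ℝ := fun z => max δ (min (px z) δ⁻¹) with hf
    have hfm : Measurable f := measurable_const.max (hpxm.min measurable_const)
    have hfδ : ∀ z, δ ≤ f z := fun z => le_max_left _ _
    have hf0 : ∀ z, 0 < f z := fun z => hδ.trans_le (hfδ z)
    have hfC : ∀ z, f z ≤ max δ δ⁻¹ := fun z => max_le_max le_rfl (min_le_right _ _)
    have hfi : ∀ w, Integrable f (P w) := fun w =>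
      Integrable.of_mem_Icc δ (max δ δ⁻¹) hfm.aemeasurable
        (ae_of_all _ fun z => ⟨hfδ z, hfC z⟩)
    have hlog : Integrable (fun z => Real.log (f z)) (P x) :=
      Integrable.of_mem_Icc (Real.log δ) (Real.log (max δ δ⁻¹)) hfm.log.aemeasurable
        (ae_of_all _ fun z =>
          ⟨Real.log_le_log hδ (hfδ z), Real.log_le_log (hf0 z) (hfC z)⟩)
    have hfy : 0 < ∫ z, f z ∂(P y) := by
      have h : ∫ _, δ ∂(P y) ≤ ∫ z, f z ∂(P y) :=
        integral_mono (integrable_const _) (hfi y) hfδ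
      simp only [integral_const, probReal_univ, one_smul] at h
      exact hδ.trans_le h
    have hH := hLH (fun z => f z / δ) (hfm.div_const δ) (fun z => (one_le_div hδ).2 (hfδ z))
      ⟨max δ δ⁻¹ / δ, fun z => div_le_div_of_nonneg_right (hfC z) hδ.le⟩ x y
    simp_rw [fun z => Real.log_div (hf0 z).ne' hδ.ne'] at hH
    rw [integral_div, Real.log_div hfy.ne' hδ.ne',
      integral_sub hlog (integrable_const _)] at hH
    simp only [integral_const, probReal_univ, one_smul] at hH
    have hL : -δ ≤ ∫ z, Real.log (f z) ∂(P x) :=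
      neg_le_integral_log_truncation hpxm hpx0 hPx hδ
    have hexp : Real.exp (-δ - Ψ x y) ≤ ∫ z, f z ∂(P y) := by
      rw [← Real.le_log_iff_exp_le hfy]
      linarith
    calc ENNReal.ofReal (Real.exp (-δ - Ψ x y))
        ≤ ENNReal.ofReal (∫ z, f z ∂(P y)) := ENNReal.ofReal_le_ofReal hexp
      _ = ∫⁻ z, ENNReal.ofReal (f z) ∂(P y) :=
          ofReal_integral_eq_lintegral_ofReal (hfi y) (ae_of_all _ fun z => (hf0 z).le)
      _ ≤ ∫⁻ z, (ENNReal.ofReal (px z) + ENNReal.ofReal δ) ∂(P y) := by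
          refine lintegral_mono fun z => ?_
          rw [← ENNReal.ofReal_add (hpx0 z) hδ.le]
          refine ENNReal.ofReal_le_ofReal (max_le ?_ ((min_le_left _ _).trans ?_))
          · linarith [hpx0 z]
          · linarith
      _ = I + ENNReal.ofReal δ := by
          rw [lintegral_add_right _ measurable_const, lintegral_const, measure_univ, mul_one,
            hPy, lintegral_withDensity_eq_lintegral_mul _ hpym.ennreal_ofReal
              hpxm.ennreal_ofReal, hI]
          simp only [Pi.mul_apply, mul_comm]
  have hl : Tendsto (fun δ : ℝ => ENNReal.ofReal (Real.exp (-δ - Ψ x y)))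
      (nhdsWithin 0 (Set.Ioi 0)) (nhds (ENNReal.ofReal (Real.exp (-(Ψ x y))))) := by
    have h : Continuous fun δ : ℝ => ENNReal.ofReal (Real.exp (-δ - Ψ x y)) :=
      ENNReal.continuous_ofReal.comp (by fun_prop)
    simpa using (h.tendsto 0).mono_left nhdsWithin_le_nhds
  have hr : Tendsto (fun δ : ℝ => I + ENNReal.ofReal δ)
      (nhdsWithin 0 (Set.Ioi 0)) (nhds I) := by
    have h : Continuous fun δ : ℝ => I + ENNReal.ofReal δ :=
      continuous_const.add ENNReal.continuous_ofReal
    simpa using (h.tendsto 0).mono_left nhdsWithin_le_nhds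
  exact le_of_tendsto_of_tendsto hl hr (eventually_mem_nhdsWithin.mono key)
end

section
/- Let E be a topological space equipped with its Borel σ-algebra and let P be a Markov kernel on E satisfying the log-Harnack inequality with rate Ψ : E×E → [0,∞). If for every x ∈ E one has Ψ(x,y) + Ψ(y,x) → 0 as y → x, then P is strong Feller: for every bounded measurable f : E → ℝ, the map x ↦ Pf(x) is continuous on E. -/
open MeasureTheory ProbabilityTheory Filter

/-- The elementary lower bound `u - u ^ 2 ≤ log (1 + u)` for nonnegative `u`. -/
theorem sub_sq_le_log_one_add {u : ℝ} (hu : 0 ≤ u) : u - u ^ 2 ≤ Real.log (1 + u) := by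
  refine le_trans ?_ (Real.one_sub_inv_le_log_of_pos (by positivity : 0 < 1 + u))
  have h : 1 - (1 + u)⁻¹ - (u - u ^ 2) = u ^ 3 / (1 + u) := by field_simp; ring
  have : 0 ≤ u ^ 3 / (1 + u) := by positivity
  linarith

/-- If the entropy-cost bound `∫ log g ∂μ ≤ log (∫ g ∂ν) + c` holds for the function
`g = 1 + ε * h`, where `0 ≤ h ≤ M`, then the integrals of `h` are close. -/
theorem integral_sub_integral_le_of_log_le {E : Type*} [MeasurableSpace E]
    {μ ν : Measure E} [IsProbabilityMeasure μ] [IsProbabilityMeasure ν]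
    {h : E → ℝ} {M ε c : ℝ} (hm : Measurable h) (h0 : ∀ z, 0 ≤ h z) (hM : ∀ z, h z ≤ M)
    (hε : 0 < ε)
    (hlog : ∫ z, Real.log (1 + ε * h z) ∂μ ≤ Real.log (∫ z, (1 + ε * h z) ∂ν) + c) :
    ∫ z, h z ∂μ - ∫ z, h z ∂ν ≤ ε * M ^ 2 + c / ε := by
  have hint (ρ : Measure E) [IsProbabilityMeasure ρ] : Integrable h ρ :=
    .of_bound hm.aestronglyMeasurable M
      (ae_of_all _ fun z => by rw [Real.norm_of_nonneg (h0 z)]; exact hM z)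
  have hlow : ε * ∫ z, h z ∂μ - ε ^ 2 * M ^ 2 ≤ ∫ z, Real.log (1 + ε * h z) ∂μ := by
    have hlogint : Integrable (fun z => Real.log (1 + ε * h z)) μ := by
      refine ((hint μ).const_mul ε).mono
        (Real.measurable_log.comp ((hm.const_mul ε).const_add 1)).aestronglyMeasurable
        (ae_of_all _ fun z => ?_)
      have hz : 0 ≤ ε * h z := mul_nonneg hε.le (h0 z)
      rw [Real.norm_of_nonneg (Real.log_nonneg (by linarith)), Real.norm_of_nonneg hz]
      linarith [Real.log_le_sub_one_of_pos (by linarith : 0 < 1 + ε * h z)]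
    calc ε * ∫ z, h z ∂μ - ε ^ 2 * M ^ 2 = ∫ z, (ε * h z - ε ^ 2 * M ^ 2) ∂μ := by
          rw [integral_sub ((hint μ).const_mul ε) (integrable_const _), integral_const_mul]
          simp
      _ ≤ _ := by
          refine integral_mono (((hint μ).const_mul ε).sub (integrable_const _)) hlogint
            fun z => ?_
          have hsq : h z ^ 2 ≤ M ^ 2 := pow_le_pow_left₀ (h0 z) (hM z) 2
          have := sub_sq_le_log_one_add (mul_nonneg hε.le (h0 z))
          have := mul_le_mul_of_nonneg_left hsq (sq_nonneg ε)
          simp only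
          nlinarith
  have hup : Real.log (∫ z, (1 + ε * h z) ∂ν) ≤ ε * ∫ z, h z ∂ν := by
    have heq : ∫ z, (1 + ε * h z) ∂ν = 1 + ε * ∫ z, h z ∂ν := by
      rw [integral_add (integrable_const _) ((hint ν).const_mul ε), integral_const_mul]
      simp
    have hpos : 0 ≤ ε * ∫ z, h z ∂ν := mul_nonneg hε.le (integral_nonneg h0)
    rw [heq]
    linarith [Real.log_le_sub_one_of_pos (by linarith : 0 < 1 + ε * ∫ z, h z ∂ν)]
  have hdiv : ε * M ^ 2 + c / ε = (ε ^ 2 * M ^ 2 + c) / ε := by field_simp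
  rw [hdiv, le_div_iff₀ hε]
  linarith

/-- A Markov kernel satisfying the log-Harnack inequality with rate `Ψ`
vanishing continuously on the diagonal is strong Feller. -/
theorem stmt_8 {E : Type*} [TopologicalSpace E] [MeasurableSpace E] [BorelSpace E]
    (P : Kernel E E) [IsMarkovKernel P]
    (Ψ : E → E → ℝ) (hΨ0 : ∀ x y, 0 ≤ Ψ x y)
    (hLH : ∀ (f : E → ℝ), Measurable f → (∀ z, 1 ≤ f z) → (∃ C, ∀ z, f z ≤ C) →
      ∀ x y : E, ∫ z, Real.log (f z) ∂(P x) ≤ Real.log (∫ z, f z ∂(P y)) + Ψ x y)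
    (hΨcont : ∀ x : E, Tendsto (fun y => Ψ x y + Ψ y x) (nhds x) (nhds 0)) :
    ∀ f : E → ℝ, Measurable f → (∃ C, ∀ z, |f z| ≤ C) →
      Continuous fun x => ∫ z, f z ∂(P x) := by
  rintro f hf ⟨C, hC⟩
  have hintf (x : E) : Integrable f (P x) :=
    .of_bound hf.aestronglyMeasurable C (ae_of_all _ hC)
  have key (ε : ℝ) (hε : 0 < ε) (x y : E) :
      ∫ z, f z ∂(P x) - ∫ z, f z ∂(P y) ≤ ε * (2 * C) ^ 2 + Ψ x y / ε := by
    have h0 (z : E) : 0 ≤ f z + C := by linarith [(abs_le.1 (hC z)).1]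
    have hM (z : E) : f z + C ≤ 2 * C := by linarith [(abs_le.1 (hC z)).2]
    have := integral_sub_integral_le_of_log_le (hf.add_const C) h0 hM hε
      (hLH (fun z => 1 + ε * (f z + C)) (((hf.add_const C).const_mul ε).const_add 1)
        (fun z => by linarith [mul_nonneg hε.le (h0 z)])
        ⟨1 + ε * (2 * C), fun z => by linarith [mul_le_mul_of_nonneg_left (hM z) hε.le]⟩ x y)
    rw [integral_add (hintf x) (integrable_const _),
      integral_add (hintf y) (integrable_const _)] at this
    simpa using this
  refine continuous_iff_continuousAt.2 fun x => Metric.tendsto_nhds.2 fun δ hδ => ?_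
  obtain ⟨ε, hε, hεδ⟩ : ∃ ε > 0, ε * (2 * C) ^ 2 < δ / 2 := by
    refine ⟨δ / 2 / ((2 * C) ^ 2 + 1), by positivity, ?_⟩
    rw [div_mul_eq_mul_div, div_lt_iff₀ (by positivity)]
    linarith
  filter_upwards [(hΨcont x).eventually_lt_const (by positivity : 0 < δ / 2 * ε)] with y hy
  have hxy : Ψ x y / ε < δ / 2 := (div_lt_iff₀ hε).2 (by linarith [hΨ0 y x])
  have hyx : Ψ y x / ε < δ / 2 := (div_lt_iff₀ hε).2 (by linarith [hΨ0 x y])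
  rw [Real.dist_eq, abs_lt]
  constructor <;> linarith [key ε hε x y, key ε hε y x]
end

section
/- Let E be a measurable space, P a Markov kernel on E, and g : E → [0,∞) a measurable function such that P(x, {z ∈ E : g(z) = g(x)}) = 1 for every x ∈ E. Suppose there is a function H : E×E → ℝ such that for every bounded measurable f : E → ℝ with f ≥ 1 and all x, y ∈ E, (P log f)(x) ≤ log(Pf(y)) + H(y,x). Then g is constant: g(x) = g(y) for all x, y ∈ E. (This is the argument showing the log-Harnack inequality for the delay semigroup cannot hold at times T ≤ r₀, where g(ξ) = |ξ(T−r₀)| is deterministic under each transition probability.) -/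
open MeasureTheory ProbabilityTheory Filter

/-- If `g ≥ 0` is measurable and deterministic under each transition
probability of the Markov kernel `P` (i.e. `P x` is supported on `{g = g x}`), and a
log-Harnack-type inequality holds with some finite rate `H`, then `g` is constant. -/
theorem stmt_9 {E : Type*} [MeasurableSpace E]
    (P : Kernel E E) [IsMarkovKernel P]
    (g : E → ℝ) (hg : Measurable g) (hg0 : ∀ x, 0 ≤ g x)
    (hdet : ∀ x : E, P x {z | g z = g x} = 1)
    (H : E → E → ℝ)
    (hLH : ∀ (f : E → ℝ), Measurable f → (∀ z, 1 ≤ f z) → (∃ C, ∀ z, f z ≤ C) →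
      ∀ x y : E, ∫ z, Real.log (f z) ∂(P x) ≤ Real.log (∫ z, f z ∂(P y)) + H y x) :
    ∀ x y : E, g x = g y := by
  intro x y
  by_contra hxy
  have hae (w : E) : ∀ᵐ z ∂(P w), g z = g w :=
    (mem_ae_iff_prob_eq_one (hg (measurableSet_singleton (g w)))).2 (hdet w)
  set n : ℝ := |H y x| + 1 with hn
  have hn0 : 0 ≤ n := by positivity
  classical
  let f : E → ℝ := fun z => if g z = g x then Real.exp n else 1
  have hf : Measurable f :=
    Measurable.ite (hg (measurableSet_singleton (g x))) measurable_const measurable_const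
  have hf1 (z : E) : 1 ≤ f z := by
    dsimp only [f]
    split_ifs
    · exact Real.one_le_exp hn0
    · exact le_rfl
  have hfb (z : E) : f z ≤ Real.exp n := by
    dsimp only [f]
    split_ifs
    · exact le_rfl
    · exact Real.one_le_exp hn0
  have hlog : ∫ z, Real.log (f z) ∂(P x) = n := by
    have h : (fun z => Real.log (f z)) =ᵐ[P x] fun _ => n := by
      filter_upwards [hae x] with z hz
      simp [f, hz]
    simp [integral_congr_ae h]
  have hint : ∫ z, f z ∂(P y) = 1 := by
    have h : f =ᵐ[P y] fun _ => 1 := by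
      filter_upwards [hae y] with z hz
      simp [f, hz, Ne.symm hxy]
    simp [integral_congr_ae h]
  have key := hLH f hf hf1 ⟨_, hfb⟩ x y
  rw [hlog, hint, Real.log_one, zero_add] at key
  linarith [le_abs_self (H y x)]
end

section
/- Let (Ω, 𝔉, μ) be a probability space with a filtration (ℱ_r)_{r ≥ 0}, and let M : [0,∞) → Ω → ℝ be a submartingale with respect to (ℱ_r) and μ such that r ↦ M(r)(ω) is continuous for every ω. Fix t ≥ 0 and assume exp(M(r)) is μ-integrable for every r ∈ [0,t]. Then E[ sup_{r ∈ [0,t]} exp(M(r)) ] ≤ e · E[ exp(M(t)) ], where e is Euler's number. (This follows from Doob's L^p maximal inequality applied to the submartingales exp(M/p) and letting p → ∞.) -/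
open MeasureTheory Set
open scoped ENNReal NNReal

section RunningMaximum

open Filter Topology

variable {Ω ι : Type*} [Preorder ι] {m0 : MeasurableSpace Ω} {μ : Measure Ω}

/-- The maximum of the truncations at level `K` of `x 0, …, x n`. -/
noncomputable def truncMax (K : ℝ) (x : ℕ → Ω → ℝ) : ℕ → Ω → ℝ
  | 0 => fun ω => min K (x 0 ω)
  | n + 1 => fun ω => max (truncMax K x n ω) (min K (x (n + 1) ω))

lemma truncMax_le (K : ℝ) (x : ℕ → Ω → ℝ) (n : ℕ) (ω : Ω) : truncMax K x n ω ≤ K := by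
  induction n with
  | zero => exact min_le_left _ _
  | succ n ih => exact max_le ih (min_le_left _ _)

lemma min_le_truncMax (K : ℝ) (x : ℕ → Ω → ℝ) {k n : ℕ} (h : k ≤ n) (ω : Ω) :
    min K (x k ω) ≤ truncMax K x n ω := by
  induction n, h using Nat.le_induction with
  | base =>
    cases k with
    | zero => exact le_rfl
    | succ k => exact le_max_right _ _
  | succ n _ ih => exact ih.trans (le_max_left _ _)

lemma integrable_truncMax [IsFiniteMeasure μ] (K : ℝ) {x : ℕ → Ω → ℝ}
    (hx : ∀ k, Integrable (x k) μ) (n : ℕ) : Integrable (truncMax K x n) μ := by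
  induction n with
  | zero => exact (integrable_const K).inf (hx 0)
  | succ n ih => exact ih.sup ((integrable_const K).inf (hx (n + 1)))

lemma stronglyMeasurable_truncMax (K : ℝ) {ℱ : Filtration ι m0} {M : ι → Ω → ℝ}
    (hM : StronglyAdapted ℱ M) {τ : ℕ → ι} (hτ : Monotone τ) (n : ℕ) :
    StronglyMeasurable[ℱ (τ n)] (truncMax K (fun k => M (τ k)) n) := by
  have hmin : ∀ k, StronglyMeasurable[ℱ (τ k)] fun ω => min K (M (τ k) ω) := fun k =>
    (continuous_const.min continuous_id).comp_stronglyMeasurable (hM (τ k))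
  induction n with
  | zero => exact hmin 0
  | succ n ih =>
    exact continuous_max.comp_stronglyMeasurable
      ((ih.mono (ℱ.mono (hτ n.le_succ))).prodMk (hmin (n + 1)))

lemma integrable_exp_truncMax_mul [IsFiniteMeasure μ] (K : ℝ) {x : ℕ → Ω → ℝ}
    (hx : ∀ k, Integrable (x k) μ) (n : ℕ) {g : Ω → ℝ} (hg : Integrable g μ) :
    Integrable (fun ω => Real.exp (truncMax K x n ω) * g ω) μ := by
  refine hg.bdd_mul (c := Real.exp K)
    (Real.continuous_exp.comp_aestronglyMeasurable (integrable_truncMax K hx n).1) ?_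
  refine ae_of_all _ fun ω => ?_
  rw [Real.norm_eq_abs, Real.abs_exp]
  exact Real.exp_le_exp.2 (truncMax_le K x n ω)

/-- A bounded nonnegative weight known at time `i` has nonnegative mean against a later increment
of a submartingale. -/
lemma MeasureTheory.Submartingale.integral_mul_sub_nonneg [IsFiniteMeasure μ]
    {ℱ : Filtration ι m0} {M : ι → Ω → ℝ} (hM : Submartingale M ℱ μ) {i j : ι} (hij : i ≤ j)
    {f : Ω → ℝ} (hf : StronglyMeasurable[ℱ i] f) (hf0 : 0 ≤ f)
    (hint : Integrable (fun ω => f ω * (M j ω - M i ω)) μ) :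
    0 ≤ ∫ ω, f ω * (M j ω - M i ω) ∂μ := by
  have hd : Integrable (M j - M i) μ := (hM.integrable j).sub (hM.integrable i)
  rw [← integral_condExp (ℱ.le i)]
  refine integral_nonneg_of_ae ?_
  have h := condExp_mul_of_stronglyMeasurable_left hf (g := M j - M i) hint hd
  filter_upwards [h, hM.condExp_sub_nonneg hij] with ω h1 h2
  change 0 ≤ (μ[f * (M j - M i) | ℱ i]) ω
  rw [h1]
  exact mul_nonneg (hf0 ω) h2

lemma exp_mul_le_exp_max_mul (K s y : ℝ) :
    Real.exp s * (1 + y - s) ≤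
      Real.exp (max s (min K y)) * (1 + y - max s (min K y)) := by
  rcases le_total (min K y) s with h | h
  · rw [max_eq_left h]
  · rw [max_eq_right h]
    set a := min K y
    have hay : a ≤ y := min_le_right _ _
    have h1 : Real.exp s * (1 + (a - s)) ≤ Real.exp a := by
      calc Real.exp s * (1 + (a - s)) ≤ Real.exp s * Real.exp (a - s) := by
            gcongr
            linarith [Real.add_one_le_exp (a - s)]
        _ = Real.exp a := by rw [← Real.exp_add]; congr 1; ring
    calc Real.exp s * (1 + y - s) ≤ Real.exp s * ((1 + (a - s)) * (1 + y - a)) := by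
          gcongr
          nlinarith [mul_nonneg (sub_nonneg.2 h) (sub_nonneg.2 hay)]
      _ = Real.exp s * (1 + (a - s)) * (1 + y - a) := by ring
      _ ≤ Real.exp a * (1 + y - a) := by
          gcongr
          linarith

lemma integral_exp_truncMax_mul_nonneg [IsFiniteMeasure μ] (K : ℝ) {ℱ : Filtration ι m0}
    {M : ι → Ω → ℝ} (hM : Submartingale M ℱ μ) {τ : ℕ → ι} (hτ : Monotone τ) (n : ℕ) :
    0 ≤ ∫ ω, Real.exp (truncMax K (fun k => M (τ k)) n ω) *
      (1 + M (τ n) ω - truncMax K (fun k => M (τ k)) n ω) ∂μ := by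
  have hx : ∀ k, Integrable (M (τ k)) μ := fun k => hM.integrable _
  set S := truncMax K (fun k => M (τ k))
  have hG : ∀ k, Integrable (fun ω => Real.exp (S k ω) * (1 + M (τ k) ω - S k ω)) μ := fun k =>
    integrable_exp_truncMax_mul K hx k
      (((integrable_const 1).add (hx k)).sub (integrable_truncMax K hx k))
  induction n with
  | zero =>
    refine integral_nonneg fun ω => mul_nonneg (Real.exp_pos _).le ?_
    have : S 0 ω ≤ M (τ 0) ω := min_le_right _ _
    linarith
  | succ n ih =>
    have hD : Integrable (fun ω => Real.exp (S n ω) * (M (τ (n + 1)) ω - M (τ n) ω)) μ :=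
      integrable_exp_truncMax_mul K hx n ((hx (n + 1)).sub (hx n))
    have hDnn := hM.integral_mul_sub_nonneg (hτ n.le_succ)
      (f := fun ω => Real.exp (S n ω))
      (Real.continuous_exp.comp_stronglyMeasurable (stronglyMeasurable_truncMax K hM.1 hτ n))
      (fun ω => (Real.exp_pos _).le) hD
    refine (add_nonneg ih hDnn).trans ?_
    rw [← integral_add (hG n) hD]
    refine integral_mono ((hG n).add hD) (hG (n + 1)) fun ω => ?_
    have h := exp_mul_le_exp_max_mul K (S n ω) (M (τ (n + 1)) ω)
    calc _ = Real.exp (S n ω) * (1 + M (τ (n + 1)) ω - S n ω) := by ring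
      _ ≤ _ := h

/-- The discrete-time form of the maximal inequality, for truncated running maxima. -/
lemma lintegral_exp_truncMax_le [IsFiniteMeasure μ] (K : ℝ) {ℱ : Filtration ι m0}
    {M : ι → Ω → ℝ} (hM : Submartingale M ℱ μ) {τ : ℕ → ι} (hτ : Monotone τ) (n : ℕ)
    (hint : Integrable (fun ω => Real.exp (M (τ n) ω)) μ) :
    ∫⁻ ω, ENNReal.ofReal (Real.exp (truncMax K (fun k => M (τ k)) n ω)) ∂μ ≤
      ENNReal.ofReal (Real.exp 1) * ∫⁻ ω, ENNReal.ofReal (Real.exp (M (τ n) ω)) ∂μ := by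
  have hx : ∀ k, Integrable (M (τ k)) μ := fun k => hM.integrable _
  set S := truncMax K (fun k => M (τ k))
  have hE : Integrable (fun ω => Real.exp (S n ω)) μ := by
    simpa using integrable_exp_truncMax_mul K hx n (integrable_const 1)
  have hG : Integrable (fun ω => Real.exp (S n ω) * (1 + M (τ n) ω - S n ω)) μ :=
    integrable_exp_truncMax_mul K hx n
      (((integrable_const 1).add (hx n)).sub (integrable_truncMax K hx n))
  rw [← ofReal_integral_eq_lintegral_ofReal hE (ae_of_all _ fun ω => (Real.exp_pos _).le),
    ← ofReal_integral_eq_lintegral_ofReal hint (ae_of_all _ fun ω => (Real.exp_pos _).le),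
    ← ENNReal.ofReal_mul (Real.exp_pos _).le, ← integral_const_mul]
  refine ENNReal.ofReal_le_ofReal ?_
  refine (le_add_of_nonneg_right (integral_exp_truncMax_mul_nonneg K hM hτ n)).trans ?_
  rw [← integral_add hE hG]
  refine integral_mono (hE.add hG) (hint.const_mul _) fun ω => ?_
  calc Real.exp (S n ω) + Real.exp (S n ω) * (1 + M (τ n) ω - S n ω)
      = Real.exp (S n ω) * ((1 + M (τ n) ω - S n ω) + 1) := by ring
    _ ≤ Real.exp (S n ω) * Real.exp (1 + M (τ n) ω - S n ω) := by
        gcongr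
        exact Real.add_one_le_exp _
    _ = Real.exp 1 * Real.exp (M (τ n) ω) := by
        rw [← Real.exp_add, ← Real.exp_add]; congr 1; ring

lemma tendsto_floor_mul_div_succ (r : ℝ≥0) :
    Tendsto (fun n : ℕ => (⌊r * (n + 1)⌋₊ : ℝ≥0) / (n + 1)) atTop (𝓝 r) := by
  rw [← NNReal.tendsto_coe]
  have h := (tendsto_nat_floor_mul_div_atTop (R := ℝ) r.2).comp
    (tendsto_atTop_add_const_right _ (1 : ℝ) tendsto_natCast_atTop_atTop)
  refine h.congr fun n => ?_
  have : ⌊(r : ℝ) * (n + 1)⌋₊ = ⌊r * ((n : ℝ≥0) + 1)⌋₊ := by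
    refine (Nat.floor_eq_iff (by positivity)).2 ⟨?_, ?_⟩
    · exact_mod_cast Nat.floor_le (zero_le (a := r * ((n : ℝ≥0) + 1)))
    · exact_mod_cast Nat.lt_floor_add_one (r * ((n : ℝ≥0) + 1))
  simp [this]

/-- The equally spaced grid of mesh `1 / (n + 1)`, stopped at `t`. -/
noncomputable def stoppedGrid (t : ℝ≥0) (n k : ℕ) : ℝ≥0 := min t (k / (n + 1))

lemma monotone_stoppedGrid (t : ℝ≥0) (n : ℕ) : Monotone (stoppedGrid t n) := fun a b hab =>
  min_le_min_left _ (by gcongr)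

lemma stoppedGrid_ceil (t : ℝ≥0) (n : ℕ) : stoppedGrid t n ⌈t * (n + 1)⌉₊ = t :=
  min_eq_left <| by
    rw [le_div_iff₀ (by positivity)]
    exact Nat.le_ceil _

lemma tendsto_stoppedGrid_floor {r t : ℝ≥0} (h : r ≤ t) :
    Tendsto (fun n : ℕ => stoppedGrid t n ⌊r * (n + 1)⌋₊) atTop (𝓝 r) := by
  simpa [stoppedGrid, min_eq_right h] using
    (tendsto_const_nhds (x := t)).min (tendsto_floor_mul_div_succ r)

lemma iSup_exp_le_liminf_exp_truncMax {M : ℝ≥0 → Ω → ℝ} {ω : Ω}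
    (hcont : Continuous fun r => M r ω) (t : ℝ≥0) :
    ⨆ r ∈ Icc (0 : ℝ≥0) t, ENNReal.ofReal (Real.exp (M r ω)) ≤
      liminf (fun n : ℕ => ENNReal.ofReal (Real.exp
        (truncMax n (fun k => M (stoppedGrid t n k)) ⌈t * (n + 1)⌉₊ ω))) atTop := by
  refine iSup₂_le fun r hr => ?_
  have h1 : Tendsto (fun n : ℕ => M (stoppedGrid t n ⌊r * (n + 1)⌋₊) ω) atTop (𝓝 (M r ω)) :=
    (hcont.tendsto r).comp (tendsto_stoppedGrid_floor hr.2)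
  have h2 : Tendsto
      (fun n : ℕ => min (n : ℝ) (M (stoppedGrid t n ⌊r * (n + 1)⌋₊) ω)) atTop (𝓝 (M r ω)) := by
    refine h1.congr' ?_
    filter_upwards [h1.eventually_lt_const (lt_add_one (M r ω)),
      tendsto_natCast_atTop_atTop.eventually_ge_atTop (M r ω + 1)] with n hn hn'
    exact (min_eq_right (hn.le.trans hn')).symm
  have h3 := ENNReal.tendsto_ofReal ((Real.continuous_exp.tendsto _).comp h2)
  rw [← h3.liminf_eq]
  refine liminf_le_liminf (Eventually.of_forall fun n => ?_)
  refine ENNReal.ofReal_le_ofReal (Real.exp_le_exp.2 ?_)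
  refine min_le_truncMax n (fun k => M (stoppedGrid t n k)) ?_ ω
  exact (Nat.floor_le_floor (by gcongr; exact hr.2)).trans (Nat.floor_le_ceil _)

end RunningMaximum

/-- For a pathwise-continuous submartingale `M` with `exp (M r)` integrable
for `r ∈ [0,t]`, one has `E[sup_{r ≤ t} exp (M r)] ≤ e · E[exp (M t)]`. -/
theorem stmt_11 {Ω : Type*} {m0 : MeasurableSpace Ω} {μ : Measure Ω}
    [IsProbabilityMeasure μ] (ℱ : Filtration ℝ≥0 m0)
    (M : ℝ≥0 → Ω → ℝ) (hM : Submartingale M ℱ μ)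
    (hcont : ∀ ω, Continuous fun r => M r ω)
    (t : ℝ≥0)
    (hint : ∀ r ∈ Icc (0 : ℝ≥0) t, Integrable (fun ω => Real.exp (M r ω)) μ) :
    ∫⁻ ω, ⨆ r ∈ Icc (0 : ℝ≥0) t, ENNReal.ofReal (Real.exp (M r ω)) ∂μ ≤
      ENNReal.ofReal (Real.exp 1) * ∫⁻ ω, ENNReal.ofReal (Real.exp (M t ω)) ∂μ := by
  refine (lintegral_mono fun ω => iSup_exp_le_liminf_exp_truncMax (hcont ω) t).trans ?_
  refine (lintegral_liminf_le fun n => ?_).trans ?_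
  · have h := stronglyMeasurable_truncMax n hM.1 (monotone_stoppedGrid t n) ⌈t * (n + 1)⌉₊
    exact (Real.measurable_exp.comp (h.mono (ℱ.le _)).measurable).ennreal_ofReal
  · refine Filter.liminf_le_of_le (by isBoundedDefault) fun b hb => ?_
    obtain ⟨n, hn⟩ := hb.exists
    refine hn.trans ?_
    have h := lintegral_exp_truncMax_le n hM (monotone_stoppedGrid t n) ⌈t * (n + 1)⌉₊
    rw [stoppedGrid_ceil] at h
    exact h (hint t ⟨zero_le, le_rfl⟩)
end

section
/- Let E be a measurable space, P a Markov kernel on E, μ₀ an invariant probability measure of P, and p : E×E → [0,∞) a jointly measurable kernel of P with respect to μ₀, i.e. Pf(x) = ∫ p(x,y) f(y) μ₀(dy) for every x ∈ E and every bounded measurable f. Let f : E → [0,∞) be measurable with ∫ f dμ₀ = 1, and suppose the probability measure μ₁ := f·μ₀ is also invariant for P. Then for μ₀-almost every x ∈ E, ∫_E p(y,x) f(y) μ₀(dy) = f(x). (Equivalently, the adjoint operator P* of P in L²(μ₀) satisfies P*f = f μ₀-a.e.) -/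
open MeasureTheory ProbabilityTheory

/-- A probability measure whose integrals of bounded measurable functions are given by a
nonnegative real density is the measure with that density. -/
theorem eq_withDensity_of_integral_eq {E : Type*} [MeasurableSpace E]
    {μ ν : Measure E} [IsProbabilityMeasure ν] {q : E → ℝ} (hq0 : ∀ y, 0 ≤ q y)
    (h : ∀ g : E → ℝ, Measurable g → (∃ C, ∀ z, |g z| ≤ C) →
      ∫ z, g z ∂ν = ∫ y, q y * g y ∂μ) :
    ν = μ.withDensity fun y => ENNReal.ofReal (q y) := by
  have h_one : ∫ y, q y ∂μ = 1 := by
    simpa using (h (fun _ => 1) measurable_const ⟨1, by simp⟩).symm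
  have h_int : Integrable q μ := by
    by_contra hn
    simp [integral_undef hn] at h_one
  ext A hA
  have hA' := h (A.indicator 1) (measurable_one.indicator hA)
    ⟨1, fun z => by by_cases hz : z ∈ A <;> simp [hz]⟩
  have h_mul : (fun y => q y * A.indicator 1 y) = A.indicator q := by
    ext y
    by_cases hy : y ∈ A <;> simp [hy]
  rw [integral_indicator_one hA, h_mul, integral_indicator hA] at hA'
  rw [withDensity_apply _ hA,
    ← ofReal_integral_eq_lintegral_ofReal h_int.integrableOn (ae_of_all _ hq0), ← hA',
    ofReal_measureReal]

/-- Averaging measures with density `q x` over `μ` with density `f` gives the density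
`y ↦ ∫⁻ x, f x * q x y ∂μ`. -/
theorem bind_withDensity {E : Type*} [MeasurableSpace E] (P : Kernel E E)
    (μ : Measure E) [SFinite μ] {q : E → E → ENNReal} (hq : Measurable (Function.uncurry q))
    {f : E → ENNReal} (hf : Measurable f) (hP : ∀ x, P x = μ.withDensity (q x)) :
    ((μ.withDensity f).bind fun x => P x) = μ.withDensity fun y => ∫⁻ x, f x * q x y ∂μ := by
  ext A hA
  have hPA : Measurable fun x => P x A := P.measurable_coe hA
  rw [Measure.bind_apply hA P.measurable.aemeasurable,
    lintegral_withDensity_eq_lintegral_mul _ hf hPA, withDensity_apply _ hA,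
    lintegral_lintegral_swap]
  · refine lintegral_congr fun x => ?_
    rw [Pi.mul_apply, hP, withDensity_apply _ hA]
    exact (lintegral_const_mul _ (hq.comp measurable_prodMk_left)).symm
  · exact ((hf.comp measurable_snd).mul (hq.comp measurable_swap)).aemeasurable

/-- If `p` is a jointly measurable kernel of the Markov kernel `P` w.r.t.
an invariant probability measure `μ₀`, and the probability density `f` of another
invariant measure `μ₁ = f·μ₀` is given, then `P*f = f` `μ₀`-a.e., i.e.
`∫ p(y,x) f(y) μ₀(dy) = f(x)` for `μ₀`-a.e. `x`. -/
theorem stmt_14 {E : Type*} [MeasurableSpace E]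
    (P : Kernel E E) [IsMarkovKernel P]
    (μ₀ : Measure E) [IsProbabilityMeasure μ₀]
    (hinv : (μ₀.bind fun x => P x) = μ₀)
    (p : E → E → ℝ) (hpm : Measurable (Function.uncurry p)) (hp0 : ∀ x y, 0 ≤ p x y)
    (hker : ∀ (x : E) (g : E → ℝ), Measurable g → (∃ C, ∀ z, |g z| ≤ C) →
      ∫ z, g z ∂(P x) = ∫ y, p x y * g y ∂μ₀)
    (f : E → ℝ) (hfm : Measurable f) (hf0 : ∀ x, 0 ≤ f x)
    (hf1 : ∫ x, f x ∂μ₀ = 1)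
    (hinv₁ : ((μ₀.withDensity fun x => ENNReal.ofReal (f x)).bind fun x => P x) =
      μ₀.withDensity fun x => ENNReal.ofReal (f x)) :
    ∀ᵐ x ∂μ₀, ∫ y, p y x * f y ∂μ₀ = f x := by
  have hq : Measurable (Function.uncurry fun x y => ENNReal.ofReal (p x y)) := hpm.ennreal_ofReal
  have hf : Measurable fun x => ENNReal.ofReal (f x) := hfm.ennreal_ofReal
  have h_int : Integrable f μ₀ := by
    by_contra hn
    simp [integral_undef hn] at hf1
  rw [bind_withDensity P μ₀ hq hf fun x => eq_withDensity_of_integral_eq (hp0 x) (hker x)] at hinv₁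
  have h_meas : Measurable fun y => ∫⁻ x, ENNReal.ofReal (f x) * ENNReal.ofReal (p x y) ∂μ₀ :=
    ((hf.comp measurable_snd).mul (hq.comp measurable_swap)).lintegral_prod_right'
  filter_upwards [(withDensity_eq_iff_of_sigmaFinite h_meas.aemeasurable hf.aemeasurable).1 hinv₁]
    with x hx
  have hpx : Measurable fun y => p y x := hpm.comp measurable_prodMk_right
  rw [integral_eq_lintegral_of_nonneg_ae (ae_of_all _ fun y => mul_nonneg (hp0 y x) (hf0 y))
    (hpx.mul hfm).aestronglyMeasurable]
  simp_rw [mul_comm (p _ x), ENNReal.ofReal_mul (hf0 _)]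
  rw [hx, ENNReal.toReal_ofReal (hf0 x)]
end

section
/- Let E be a measurable space, P a Markov kernel on E, and μ an invariant probability measure of P. Let H : E×E → [0,∞) be measurable and assume KL(P(b,·) ‖ P(a,·)) ≤ H(a,b) for all a, b ∈ E. Let f : E → [0,∞) be measurable with ∫ f dμ = 1, and let π be any coupling of μ and f·μ, i.e. a probability measure on E×E whose first marginal is μ and whose second marginal is f·μ. Then KL((f·μ)P ‖ μ) ≤ ∫_{E×E} H(a,b) π(da,db). (Taking the infimum over couplings π, this is the entropy–cost inequality μ((P*f) log P*f) ≤ inf_{π} ∫ H dπ for the adjoint semigroup.) -/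
open MeasureTheory ProbabilityTheory
open scoped ENNReal NNReal Classical

open Filter Topology

/-- `klDiv` agrees with Mathlib's divergence on probability measures. -/
lemma klDiv_eq_informationTheory_klDiv {E : Type*} [MeasurableSpace E] (ν μ : Measure E)
    [IsProbabilityMeasure ν] [IsProbabilityMeasure μ] :
    klDiv ν μ = InformationTheory.klDiv ν μ := by
  simp [klDiv, InformationTheory.klDiv_def]

/-- Fenchel–Young inequality for `klFun` and `x ↦ exp x - 1`. -/
lemma mul_sub_exp_sub_one_le_klFun {s : ℝ} (hs : 0 ≤ s) (x : ℝ) :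
    s * x - (Real.exp x - 1) ≤ InformationTheory.klFun s := by
  rcases hs.eq_or_lt with rfl | hs
  · simp [InformationTheory.klFun_apply, Real.exp_nonneg]
  · have h := Real.add_one_le_exp (x - Real.log s)
    rw [Real.exp_sub, Real.exp_log hs, le_div_iff₀ hs] at h
    rw [InformationTheory.klFun_apply]
    linarith

lemma integrable_of_measurable_of_abs_le {E : Type*} [MeasurableSpace E] {μ : Measure E}
    [IsFiniteMeasure μ] {g : E → ℝ} (hg : Measurable g) {K : ℝ} (hK : ∀ x, |g x| ≤ K) :
    Integrable g μ :=
  Integrable.of_bound hg.aestronglyMeasurable K (ae_of_all _ hK)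

lemma abs_exp_sub_one_le {x K : ℝ} (h : |x| ≤ K) : |Real.exp x - 1| ≤ Real.exp K + 1 := by
  have h1 := Real.exp_le_exp.mpr ((le_abs_self x).trans h)
  have h2 := Real.exp_pos x
  rw [abs_le]
  constructor <;> linarith

/-- The easy half of the variational formula for the Kullback–Leibler divergence. -/
lemma ofReal_integral_sub_integral_exp_le_klDiv {E : Type*} [MeasurableSpace E] (ν μ : Measure E)
    [IsProbabilityMeasure ν] [IsProbabilityMeasure μ] {g : E → ℝ} (hg : Measurable g) {K : ℝ}
    (hK : ∀ x, |g x| ≤ K) :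
    ENNReal.ofReal (∫ x, g x ∂ν - ∫ x, (Real.exp (g x) - 1) ∂μ) ≤ klDiv ν μ := by
  rw [klDiv_eq_informationTheory_klDiv]
  by_cases h : ν ≪ μ ∧ Integrable (llr ν μ) ν
  swap
  · simp [InformationTheory.klDiv_def, h]
  have hgν : Integrable g ν := integrable_of_measurable_of_abs_le hg hK
  have hge : Integrable (fun x => Real.exp (g x) - 1) μ :=
    integrable_of_measurable_of_abs_le (by fun_prop) fun x => abs_exp_sub_one_le (hK x)
  rw [InformationTheory.klDiv_eq_integral_klFun, if_pos h, ← integral_rnDeriv_smul h.1,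
    ← integral_sub ((integrable_rnDeriv_smul_iff h.1).mpr hgν) hge]
  refine ENNReal.ofReal_le_ofReal (integral_mono
    (((integrable_rnDeriv_smul_iff h.1).mpr hgν).sub hge)
    ((InformationTheory.integrable_klFun_rnDeriv_iff h.1).mpr h.2) fun x => ?_)
  exact mul_sub_exp_sub_one_le_klFun ENNReal.toReal_nonneg (g x)

/-- The truncation of `r` to the interval `[1 / (n + 1), n + 1]`. -/
noncomputable def clampInv (n : ℕ) (r : ℝ) : ℝ := max (1 / ((n : ℝ) + 1)) (min r (n + 1))

lemma one_div_le_clampInv (n : ℕ) (r : ℝ) : 1 / ((n : ℝ) + 1) ≤ clampInv n r :=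
  le_max_left _ _

lemma one_div_succ_le_one (n : ℕ) : 1 / ((n : ℝ) + 1) ≤ 1 :=
  (div_le_one (by positivity)).mpr (by linarith [(n.cast_nonneg : (0 : ℝ) ≤ n)])

lemma clampInv_le (n : ℕ) (r : ℝ) : clampInv n r ≤ n + 1 :=
  max_le ((one_div_succ_le_one n).trans (by linarith [(n.cast_nonneg : (0 : ℝ) ≤ n)])) (min_le_right _ _)

lemma clampInv_pos (n : ℕ) (r : ℝ) : 0 < clampInv n r :=
  lt_of_lt_of_le (by positivity) (one_div_le_clampInv n r)

@[fun_prop]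
lemma measurable_clampInv (n : ℕ) : Measurable (clampInv n) := by
  unfold clampInv
  fun_prop

lemma abs_log_clampInv_le (n : ℕ) (r : ℝ) : |Real.log (clampInv n r)| ≤ Real.log (n + 1) := by
  rw [abs_le]
  constructor
  · have := Real.log_le_log (by positivity) (one_div_le_clampInv n r)
    rwa [one_div, Real.log_inv] at this
  · exact Real.log_le_log (clampInv_pos n r) (clampInv_le n r)

lemma tendsto_clampInv {r : ℝ} (hr : 0 ≤ r) :
    Tendsto (fun n => clampInv n r) atTop (𝓝 r) := by
  have h1 : Tendsto (fun n : ℕ => min r ((n : ℝ) + 1)) atTop (𝓝 r) := by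
    refine tendsto_const_nhds.congr' ?_
    filter_upwards [eventually_ge_atTop ⌈r⌉₊] with n hn
    rw [min_eq_left]
    linarith [Nat.ceil_le.mp hn]
  simpa [clampInv, hr] using (tendsto_one_div_add_atTop_nhds_zero_nat (𝕜 := ℝ)).max h1

lemma mul_log_clampInv_sub_nonneg (n : ℕ) (r : ℝ) :
    0 ≤ r * Real.log (clampInv n r) - (clampInv n r - 1) := by
  have hpos := clampInv_pos n r
  have h1 : 0 ≤ (r - clampInv n r) * Real.log (clampInv n r) := by
    rcases le_total (clampInv n r) r with h | h
    · rcases h.eq_or_lt with h | h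
      · simp [h]
      · refine mul_nonneg (by linarith) (Real.log_nonneg ?_)
        by_contra! hlt
        have : min r ((n : ℝ) + 1) ≤ clampInv n r := le_max_right _ _
        rcases min_le_iff.mp this with h' | h' <;> linarith [n.cast_nonneg (α := ℝ)]
    · rcases h.eq_or_lt with h | h
      · simp [← h]
      · refine mul_nonneg_of_nonpos_of_nonpos (by linarith) (Real.log_nonpos hpos.le ?_)
        rcases max_choice (1 / ((n : ℝ) + 1)) (min r (n + 1)) with h' | h'
        · exact h'.trans_le (one_div_succ_le_one n)
        · exact absurd (h'.trans_le (min_le_left _ _)) (not_le.mpr h)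
  have h2 := InformationTheory.klFun_nonneg hpos.le
  rw [InformationTheory.klFun_apply] at h2
  linarith

lemma tendsto_mul_log_clampInv_sub {r : ℝ} (hr : 0 ≤ r) :
    Tendsto (fun n => r * Real.log (clampInv n r) - (clampInv n r - 1)) atTop
      (𝓝 (InformationTheory.klFun r)) := by
  have ht := tendsto_clampInv hr
  have : InformationTheory.klFun r = r * Real.log r - (r - 1) := by
    rw [InformationTheory.klFun_apply]
    ring
  rw [this]
  refine Tendsto.sub ?_ (ht.sub_const 1)
  rcases hr.eq_or_lt with rfl | hr
  · simp
  · exact ((Real.continuousAt_log hr.ne').tendsto.comp ht).const_mul r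

/-- The hard half of the variational formula for the Kullback–Leibler divergence. -/
lemma klDiv_le_of_forall_ofReal_integral_sub_le {E : Type*} [MeasurableSpace E] {ν μ : Measure E}
    [IsProbabilityMeasure ν] [IsProbabilityMeasure μ] (hνμ : ν ≪ μ) {C : ℝ≥0∞}
    (hC : ∀ g : E → ℝ, Measurable g → ∀ K, (∀ x, |g x| ≤ K) →
      ENNReal.ofReal (∫ x, g x ∂ν - ∫ x, (Real.exp (g x) - 1) ∂μ) ≤ C) :
    klDiv ν μ ≤ C := by
  rw [klDiv_eq_informationTheory_klDiv, InformationTheory.klDiv_eq_lintegral_klFun_of_ac hνμ]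
  set r : E → ℝ := fun x => (ν.rnDeriv μ x).toReal with hr
  have hrm : Measurable r := (Measure.measurable_rnDeriv ν μ).ennreal_toReal
  set F : ℕ → E → ℝ :=
    fun n x => r x * Real.log (clampInv n (r x)) - (clampInv n (r x) - 1) with hF
  have hFm : ∀ n, Measurable (F n) := fun n => by fun_prop
  calc ∫⁻ x, ENNReal.ofReal (InformationTheory.klFun (r x)) ∂μ
      = ∫⁻ x, liminf (fun n => ENNReal.ofReal (F n x)) atTop ∂μ := by
        refine lintegral_congr fun x => Tendsto.liminf_eq ?_ |>.symm
        exact ENNReal.tendsto_ofReal (tendsto_mul_log_clampInv_sub ENNReal.toReal_nonneg)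
    _ ≤ liminf (fun n => ∫⁻ x, ENNReal.ofReal (F n x) ∂μ) atTop :=
        lintegral_liminf_le fun n => (hFm n).ennreal_ofReal
    _ ≤ C := by
        refine liminf_le_of_frequently_le' (Frequently.of_forall fun n => ?_)
        have hgm : Measurable fun x => Real.log (clampInv n (r x)) := by fun_prop
        have hg := hC _ hgm _ fun x => abs_log_clampInv_le n (r x)
        have hgν : Integrable (fun x => Real.log (clampInv n (r x))) ν :=
          integrable_of_measurable_of_abs_le hgm fun x => abs_log_clampInv_le n (r x)
        have hge : Integrable (fun x => Real.exp (Real.log (clampInv n (r x))) - 1) μ :=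
          integrable_of_measurable_of_abs_le (by fun_prop)
            fun x => abs_exp_sub_one_le (abs_log_clampInv_le n (r x))
        have hgr := (integrable_rnDeriv_smul_iff hνμ).mpr hgν
        rw [← integral_rnDeriv_smul hνμ, ← integral_sub hgr hge] at hg
        have hgF : (fun x => (ν.rnDeriv μ x).toReal • Real.log (clampInv n (r x)) -
            (Real.exp (Real.log (clampInv n (r x))) - 1)) = F n := by
          ext x
          rw [Real.exp_log (clampInv_pos n (r x)), smul_eq_mul]
        have hFi : Integrable (F n) μ := hgF ▸ hgr.sub hge
        rw [hgF, ofReal_integral_eq_lintegral_ofReal hFi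
          (ae_of_all _ fun x => mul_log_clampInv_sub_nonneg n (r x))] at hg
        exact hg

lemma integral_bind_kernel {E F : Type*} [MeasurableSpace E] [MeasurableSpace F]
    (κ : Kernel E F) [IsMarkovKernel κ] (μ : Measure E) [IsFiniteMeasure μ] {g : F → ℝ}
    (hg : Integrable g (μ.bind fun x => κ x)) :
    ∫ y, g y ∂(μ.bind fun x => κ x) = ∫ x, ∫ y, g y ∂(κ x) ∂μ := by
  have h := Kernel.integral_comp (η := κ) (κ := Kernel.const Unit μ) (a := ()) (f := g)
  rw [Kernel.comp_apply, Kernel.const_apply] at h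
  exact h hg

lemma integrable_integral_kernel {E F : Type*} [MeasurableSpace E] [MeasurableSpace F]
    (κ : Kernel E F) [IsMarkovKernel κ] (μ : Measure E) [IsFiniteMeasure μ] {g : F → ℝ}
    (hg : Measurable g) {K : ℝ} (hK : ∀ y, |g y| ≤ K) :
    Integrable (fun x => ∫ y, g y ∂(κ x)) μ := by
  refine integrable_of_measurable_of_abs_le (K := K)
    hg.stronglyMeasurable.integral_kernel.measurable fun x => ?_
  simpa using norm_integral_le_of_norm_le_const (μ := κ x) (f := g) (ae_of_all _ hK)

/-- The entropy–cost inequality: if `μ` is invariant for the Markov kernel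
`P` and `KL(P b ‖ P a) ≤ H a b`, then for every probability density `f` w.r.t. `μ` and
every coupling `π` of `μ` and `f·μ`, `KL((f·μ)P ‖ μ) ≤ ∫ H dπ`. -/
theorem stmt_15 {E : Type*} [MeasurableSpace E]
    (P : Kernel E E) [IsMarkovKernel P]
    (μ : Measure E) [IsProbabilityMeasure μ]
    (hinv : (μ.bind fun x => P x) = μ)
    (H : E → E → ℝ) (hH0 : ∀ a b, 0 ≤ H a b)
    (hHmeas : Measurable fun q : E × E => H q.1 q.2)
    (hKL : ∀ a b : E, klDiv (P b) (P a) ≤ ENNReal.ofReal (H a b))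
    (f : E → ℝ) (hfm : Measurable f) (hf0 : ∀ x, 0 ≤ f x) (hf1 : ∫ x, f x ∂μ = 1)
    (π : Measure (E × E)) (hπ : IsProbabilityMeasure π)
    (hπ1 : π.map Prod.fst = μ)
    (hπ2 : π.map Prod.snd = μ.withDensity fun x => ENNReal.ofReal (f x)) :
    klDiv ((μ.withDensity fun x => ENNReal.ofReal (f x)).bind fun x => P x) μ ≤
      ∫⁻ q, ENNReal.ofReal (H q.1 q.2) ∂π := by
  have hμ2 : IsProbabilityMeasure (μ.withDensity fun x => ENNReal.ofReal (f x)) :=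
    hπ2 ▸ Measure.isProbabilityMeasure_map measurable_snd.aemeasurable
  set ρ := μ.withDensity fun x => ENNReal.ofReal (f x) with hρ
  have hν : IsProbabilityMeasure (ρ.bind fun x => P x) :=
    inferInstanceAs (IsProbabilityMeasure (P ∘ₘ ρ))
  have hac : (ρ.bind fun x => P x) ≪ μ := by
    have := Measure.AbsolutelyContinuous.comp_right (withDensity_absolutelyContinuous μ
      fun x => ENNReal.ofReal (f x)) P
    exact hinv ▸ this
  by_cases hfin : ∫⁻ q, ENNReal.ofReal (H q.1 q.2) ∂π = ∞
  · simp [hfin]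
  have hHint : Integrable (fun q : E × E => H q.1 q.2) π :=
    (lintegral_ofReal_ne_top_iff_integrable hHmeas.aestronglyMeasurable
      (ae_of_all _ fun q => hH0 q.1 q.2)).mp hfin
  refine klDiv_le_of_forall_ofReal_integral_sub_le hac fun g hg K hK => ?_
  rw [← ofReal_integral_eq_lintegral_ofReal hHint (ae_of_all _ fun q => hH0 q.1 q.2)]
  refine ENNReal.ofReal_le_ofReal ?_
  have hem : Measurable fun x => Real.exp (g x) - 1 := by fun_prop
  have heK : ∀ x, |Real.exp (g x) - 1| ≤ Real.exp K + 1 := fun x => abs_exp_sub_one_le (hK x)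
  have hsnd : ∫ x, g x ∂(ρ.bind fun x => P x) = ∫ q, ∫ y, g y ∂(P q.2) ∂π := by
    rw [integral_bind_kernel P ρ (integrable_of_measurable_of_abs_le hg hK), ← hπ2]
    exact integral_map measurable_snd.aemeasurable
      hg.stronglyMeasurable.integral_kernel.aestronglyMeasurable
  have hfst : ∫ x, (Real.exp (g x) - 1) ∂μ = ∫ q, ∫ y, (Real.exp (g y) - 1) ∂(P q.1) ∂π := by
    have h := integral_bind_kernel P μ (g := fun x => Real.exp (g x) - 1)
      (by rw [hinv]; exact integrable_of_measurable_of_abs_le hem heK)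
    rw [hinv] at h
    rw [h]
    conv_lhs => rw [← hπ1]
    exact integral_map measurable_fst.aemeasurable
      hem.stronglyMeasurable.integral_kernel.aestronglyMeasurable
  have hisnd : Integrable (fun q : E × E => ∫ y, g y ∂(P q.2)) π :=
    integrable_integral_kernel (P.comap Prod.snd measurable_snd) π hg hK
  have hifst : Integrable (fun q : E × E => ∫ y, (Real.exp (g y) - 1) ∂(P q.1)) π :=
    integrable_integral_kernel (P.comap Prod.fst measurable_fst) π hem heK
  rw [hsnd, hfst, ← integral_sub hisnd hifst]
  refine integral_mono (hisnd.sub hifst) hHint fun q => ?_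
  exact (ENNReal.ofReal_le_ofReal_iff (hH0 q.1 q.2)).mp
    ((ofReal_integral_sub_integral_exp_le_klDiv (P q.2) (P q.1) hg hK).trans (hKL q.1 q.2))
end
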